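/- arXiv:2106.04429 — 3 statements merged into one kernel-verified Lean document; each statement's English description precedes it below -/
import Mathlib

section
/- The triangular bipyramid (the convex hull of a triangle together with two apex points on opposite sides of its plane) is a conic polytope: it admits a conic sequence {𝒫_i}_{1≤i≤5} whose corresponding sequence of polytopes is 𝒞 = {pt, I, I, I²} (a point, two segments, and a square). However, it does not admit a Δ-conic sequence. -/
open Set Polynomial Metric

/-! ### Polytopes, faces, and conic sequences -/

variable {V : Type*} [NormedAddCommGroup V] [NormedSpace ℝ V]

/-- A (convex) polytope: the convex hull of a finite set. -/
def IsPolytope (P : Set V) : Prop := ∃ S : Finset V, P = convexHull ℝ (S : Set V)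

/-- `F` is a face of the polytope `P` (exposed face; this includes `∅` and `P` itself). -/
def IsFaceOf (F P : Set V) : Prop := IsExposed ℝ P F

/-- The set of all faces of a polytope, i.e. the polytopal complex of all faces of `P`. -/
def faces (P : Set V) : Set (Set V) := {F | IsFaceOf F P}

/-- The dimension of a polytope (the affine dimension of the set). -/
noncomputable def polyDim (s : Set V) : ℕ := Module.finrank ℝ (vectorSpan ℝ s)

/-- The number `f_k(Q)` of `k`-dimensional (nonempty) faces of a polytope `Q`. -/
noncomputable def faceCount (Q : Set V) (k : ℕ) : ℕ :=
  Nat.card {F : Set V // IsFaceOf F Q ∧ F.Nonempty ∧ polyDim F = k}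

/-- The generating function `Φ_Q(x) = ∑_{k=0}^{dim Q} f_k(Q) x^k` of the face numbers. -/
noncomputable def faceGen (Q : Set V) : Polynomial ℚ :=
  ∑ k ∈ Finset.range (polyDim Q + 1), Polynomial.C ((faceCount Q k : ℚ)) * Polynomial.X ^ k

/-- The dimension of a collection of polytopes: the largest dimension of a member. -/
noncomputable def cpxDim (S : Set (Set V)) : ℕ := sSup (polyDim '' S)

/-- A conic sequence `𝒫 = 𝒫_ℓ, 𝒫_{ℓ-1}, …, 𝒫_1` of a polytopal complex with cell set `K`:
at each step `2 ≤ i ≤ ℓ`, one removes the interval `[v_i, E_i]`, where `v_i` is a cone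
vertex of `𝒫_i`, i.e. a vertex such that the subposet `{F ∈ 𝒫_i : v_i ∈ F}` has a unique
maximal (equivalently, greatest) element `E_i`; the sequence ends with `𝒫_1 = {∅, {v_1}}`. -/
structure ConicSeq (K : Set (Set V)) (ℓ : ℕ) where
  cpx : ℕ → Set (Set V)
  v : ℕ → V
  E : ℕ → Set V
  one_le : 1 ≤ ℓ
  top : cpx ℓ = K
  bottom : cpx 1 = {∅, {v 1}}
  vtx_mem : ∀ i, 2 ≤ i → i ≤ ℓ → {v i} ∈ cpx i
  E_mem : ∀ i, 2 ≤ i → i ≤ ℓ → E i ∈ cpx i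
  v_mem_E : ∀ i, 2 ≤ i → i ≤ ℓ → v i ∈ E i
  E_greatest : ∀ i, 2 ≤ i → i ≤ ℓ → ∀ F ∈ cpx i, v i ∈ F → F ⊆ E i
  step : ∀ i, 2 ≤ i → i ≤ ℓ → cpx (i - 1) = cpx i \ {F | F ∈ cpx i ∧ v i ∈ F ∧ F ⊆ E i}

/-- The interval `[v_i, E_i]` removed at step `i` of a conic sequence. -/
def ConicSeq.interval {K : Set (Set V)} {ℓ : ℕ} (cs : ConicSeq K ℓ) (i : ℕ) : Set (Set V) :=
  {F | F ∈ cs.cpx i ∧ cs.v i ∈ F ∧ F ⊆ cs.E i}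

/-- `C` is the intersection of the face `E` with an affine hyperplane separating the cone
vertex `vtx` from `Pprev ∩ E`, where `Pprev` is the geometric realization `P_{i-1}`. -/
def IsConeSlice (C : Set V) (E : Set V) (vtx : V) (Pprev : Set V) : Prop :=
  ∃ (f : V →L[ℝ] ℝ) (c : ℝ), c < f vtx ∧ (∀ x ∈ Pprev ∩ E, f x < c) ∧
    C = {x ∈ E | f x = c}

/-- `C i` is the cone-slice polytope `C_i` of the conic sequence `cs`, for `2 ≤ i ≤ ℓ`. -/
def ConicSeq.HasSlices {K : Set (Set V)} {ℓ : ℕ} (cs : ConicSeq K ℓ) (C : ℕ → Set V) : Prop :=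
  ∀ i, 2 ≤ i → i ≤ ℓ → IsConeSlice (C i) (cs.E i) (cs.v i) (⋃₀ cs.cpx (i - 1))

/-- A simplex: the convex hull of a nonempty affinely independent finite set. -/
def IsSimplex (C : Set V) : Prop :=
  ∃ S : Finset V, S.Nonempty ∧ AffineIndependent ℝ (fun x : {x // x ∈ S} => (x : V)) ∧
    C = convexHull ℝ (S : Set V)

/-- A polytope combinatorially equivalent to the `d`-dimensional cube `I^d = [0,1]^d`,
i.e. whose face poset is isomorphic to that of `[0,1]^d`. -/
def IsCombCube (C : Set V) (d : ℕ) : Prop :=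
  Nonempty ({F : Set V // IsFaceOf F C} ≃o
    {F : Set (Fin d → ℝ) // IsFaceOf F (Set.Icc (0 : Fin d → ℝ) 1)})

/-- A nondegenerate segment (a copy of the interval `I`). -/
def IsSegment (C : Set V) : Prop := ∃ a b : V, a ≠ b ∧ C = segment ℝ a b

/-- A facet: a nonempty face of codimension one. -/
def IsFacetOf (F P : Set V) : Prop := IsFaceOf F P ∧ F.Nonempty ∧ polyDim F + 1 = polyDim P

/-- A simple polytope: each vertex lies on exactly `dim`-many facets. -/
def IsSimplePolytope (P : Set V) : Prop :=
  IsPolytope P ∧ P.Nonempty ∧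
    ∀ w : V, IsFaceOf {w} P → Nat.card {F : Set V // IsFacetOf F P ∧ w ∈ F} = polyDim P

/-! ### Faces of the convex hull of a finite family -/

theorem mem_convexHull_range_iff {ι : Type*} [Fintype ι] {w : ι → V} {x : V} :
    x ∈ convexHull ℝ (range w) ↔
      ∃ a : ι → ℝ, (∀ i, 0 ≤ a i) ∧ ∑ i, a i = 1 ∧ ∑ i, a i • w i = x := by
  constructor
  · intro hx
    obtain ⟨s, a, ha, ha', rfl⟩ := by
      simpa only [convexHull_range_eq_exists_affineCombination] using hx
    rw [s.affineCombination_eq_linear_combination _ _ ha']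
    classical
    refine ⟨fun i => if i ∈ s then a i else 0, fun i => ?_, ?_, ?_⟩
    · dsimp only
      split_ifs with h
      exacts [ha i h, le_rfl]
    · simpa using ha'
    · simp [ite_smul]
  · rintro ⟨a, ha, ha', rfl⟩
    exact (convex_convexHull ℝ _).sum_mem (fun i _ => ha i) ha'
      fun i _ => subset_convexHull ℝ _ (mem_range_self i)

/-- `I` is the set of indices at which some affine functional attains a bound `M` valid on the
whole family `w`. -/
def IsSupported {ι : Type*} (w : ι → V) (I : Set ι) : Prop :=
  ∃ (l : V →L[ℝ] ℝ) (M : ℝ), ∀ i, l (w i) ≤ M ∧ (l (w i) = M ↔ i ∈ I)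

theorem le_of_mem_convexHull {s : Set V} {l : V →L[ℝ] ℝ} {M : ℝ} (h : ∀ y ∈ s, l y ≤ M) {x : V}
    (hx : x ∈ convexHull ℝ s) : l x ≤ M :=
  convexHull_min (t := {y | l y ≤ M}) h (convex_halfSpace_le l.toLinearMap.isLinear M) hx

theorem lt_of_mem_convexHull {s : Set V} {l : V →L[ℝ] ℝ} {M : ℝ} (h : ∀ y ∈ s, l y < M) {x : V}
    (hx : x ∈ convexHull ℝ s) : l x < M :=
  convexHull_min (t := {y | l y < M}) h (convex_halfSpace_lt l.toLinearMap.isLinear M) hx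

theorem eq_of_mem_convexHull {s : Set V} {l : V →L[ℝ] ℝ} {M : ℝ} (h : ∀ y ∈ s, l y = M) {x : V}
    (hx : x ∈ convexHull ℝ s) : l x = M :=
  convexHull_min (t := {y | l y = M}) h (convex_hyperplane l.toLinearMap.isLinear M) hx

theorem sep_convexHull_range_eq {ι : Type*} [Fintype ι] {w : ι → V} {I : Set ι} {l : V →L[ℝ] ℝ}
    {M : ℝ} (h : ∀ i, l (w i) ≤ M ∧ (l (w i) = M ↔ i ∈ I)) :
    {x ∈ convexHull ℝ (range w) | l x = M} = convexHull ℝ (w '' I) := by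
  classical
  ext x
  constructor
  · rintro ⟨hx, hxM⟩
    obtain ⟨a, ha, ha', rfl⟩ := mem_convexHull_range_iff.1 hx
    have hsum : ∑ i, a i * (M - l (w i)) = 0 := by
      simp only [mul_sub, Finset.sum_sub_distrib, ← Finset.sum_mul, ha', one_mul]
      rw [← hxM]
      simp [map_sum]
    have hz : ∀ i, a i * (M - l (w i)) = 0 := by
      have := (Finset.sum_eq_zero_iff_of_nonneg
        (fun i _ => mul_nonneg (ha i) (sub_nonneg.2 (h i).1))).1 hsum
      exact fun i => this i (Finset.mem_univ i)
    have hI : ∀ i, i ∉ I → a i = 0 := by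
      intro i hi
      rcases mul_eq_zero.1 (hz i) with h0 | h0
      · exact h0
      · exact absurd ((h i).2.1 (by linarith)) hi
    have e1 : ∑ i with i ∈ I, a i = 1 := by
      rw [← ha']
      refine Finset.sum_filter_of_ne fun i _ hi => ?_
      by_contra hc
      exact hi (hI i hc)
    have e2 : ∑ i with i ∈ I, a i • w i = ∑ i, a i • w i := by
      refine Finset.sum_filter_of_ne fun i _ hi => ?_
      by_contra hc
      exact hi (by rw [hI i hc, zero_smul])
    rw [← e2]
    refine (convex_convexHull ℝ _).sum_mem (fun i _ => ha i) e1 fun i hi => ?_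
    exact subset_convexHull ℝ _ (mem_image_of_mem w (Finset.mem_filter.1 hi).2)
  · intro hx
    refine ⟨convexHull_mono (image_subset_range _ _) hx, eq_of_mem_convexHull ?_ hx⟩
    rintro _ ⟨i, hi, rfl⟩
    exact (h i).2.2 hi

theorem isFaceOf_convexHull_range_iff {ι : Type*} [Fintype ι] {w : ι → V} {F : Set V} :
    IsFaceOf F (convexHull ℝ (range w)) ↔ ∃ I, IsSupported w I ∧ F = convexHull ℝ (w '' I) := by
  constructor
  · intro hF
    rcases F.eq_empty_or_nonempty with rfl | hne
    · exact ⟨∅, ⟨0, 1, fun i => by simp⟩, by simp⟩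
    · obtain ⟨l, hl⟩ := hF hne
      obtain ⟨x₀, hx₀⟩ := hne
      have hx₀' := hx₀
      rw [hl] at hx₀'
      have key : ∀ i, l (w i) ≤ l x₀ ∧ (l (w i) = l x₀ ↔ i ∈ {i | l (w i) = l x₀}) :=
        fun i => ⟨hx₀'.2 _ (subset_convexHull ℝ _ (mem_range_self i)), Iff.rfl⟩
      refine ⟨{i | l (w i) = l x₀}, ⟨l, l x₀, key⟩, ?_⟩
      rw [← sep_convexHull_range_eq key, hl]
      ext x
      refine ⟨fun hx => ⟨hx.1, le_antisymm (hx₀'.2 _ hx.1) (hx.2 _ hx₀'.1)⟩, fun hx => ⟨hx.1, ?_⟩⟩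
      intro y hy
      rw [hx.2]
      exact hx₀'.2 y hy
  · rintro ⟨I, ⟨l, M, h⟩, rfl⟩ ⟨x₀, hx₀⟩
    refine ⟨l, ?_⟩
    rw [← sep_convexHull_range_eq h] at hx₀ ⊢
    have hle : ∀ y ∈ convexHull ℝ (range w), l y ≤ M := fun y hy =>
      le_of_mem_convexHull (by rintro _ ⟨i, rfl⟩; exact (h i).1) hy
    ext x
    refine ⟨fun hx => ⟨hx.1, fun y hy => (hle y hy).trans hx.2.ge⟩,
      fun hx => ⟨hx.1, le_antisymm (hle x hx.1) ?_⟩⟩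
    rw [← hx₀.2]
    exact hx.2 _ hx₀.1

theorem IsSupported.mem_convexHull_image_iff {ι : Type*} {w : ι → V} {I : Set ι}
    (h : IsSupported w I) {i : ι} : w i ∈ convexHull ℝ (w '' I) ↔ i ∈ I := by
  obtain ⟨l, M, h⟩ := h
  refine ⟨fun hi => (h i).2.1 (eq_of_mem_convexHull ?_ hi),
    fun hi => subset_convexHull ℝ _ (mem_image_of_mem w hi)⟩
  rintro _ ⟨j, hj, rfl⟩
  exact (h j).2.2 hj

theorem IsSupported.convexHull_image_subset_iff {ι : Type*} {w : ι → V} {I J : Set ι}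
    (h : IsSupported w J) : convexHull ℝ (w '' I) ⊆ convexHull ℝ (w '' J) ↔ I ⊆ J :=
  ⟨fun hs _ hi => h.mem_convexHull_image_iff.1
    (hs (subset_convexHull ℝ _ (mem_image_of_mem w hi))),
    fun hs => convexHull_mono (image_mono hs)⟩

/-- The faces of a convex hull are ordered like the supported index sets. -/
noncomputable def supportedOrderIso {ι : Type*} [Fintype ι] (w : ι → V) :
    {I : Set ι // IsSupported w I} ≃o {F : Set V // IsFaceOf F (convexHull ℝ (range w))} :=
  RelIso.ofSurjective
    (OrderEmbedding.ofMapLEIff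
      (fun I : {I : Set ι // IsSupported w I} =>
        (⟨convexHull ℝ (w '' I.1), isFaceOf_convexHull_range_iff.2 ⟨I.1, I.2, rfl⟩⟩ :
          {F : Set V // IsFaceOf F (convexHull ℝ (range w))}))
      fun _ J => J.2.convexHull_image_subset_iff)
    (by
      rintro ⟨F, hF⟩
      obtain ⟨I, hI, rfl⟩ := isFaceOf_convexHull_range_iff.1 hF
      exact ⟨⟨I, hI⟩, rfl⟩)

theorem nonempty_faces_orderIso {W : Type*} [NormedAddCommGroup W] [NormedSpace ℝ W]
    {ι : Type*} [Fintype ι] {w : ι → V} {w' : ι → W}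
    (h : ∀ I, IsSupported w I ↔ IsSupported w' I) :
    Nonempty ({F : Set V // IsFaceOf F (convexHull ℝ (range w))} ≃o
      {F : Set W // IsFaceOf F (convexHull ℝ (range w'))}) := by
  exact ⟨((supportedOrderIso w).symm.trans
    (OrderIso.setCongr _ _ (Set.ext h))).trans (supportedOrderIso w')⟩

/-! ### Families with a single affine dependency -/

/-- `c` is an affine dependency of the family `w` with no vanishing coefficient, and it is the only
constraint on the values that affine functionals take on `w`. -/
structure IsAffineCircuit {ι : Type*} [Fintype ι] (w : ι → V) (c : ι → ℝ) : Prop where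
  ne_zero : ∀ i, c i ≠ 0
  sum_eq_zero : ∑ i, c i = 0
  sum_smul_eq_zero : ∑ i, c i • w i = 0
  exists_functional : ∀ ψ : ι → ℝ, ∑ i, c i * ψ i = 0 →
    ∃ (l : V →L[ℝ] ℝ) (M : ℝ), ∀ i, l (w i) = M - ψ i

/-- The nonempty complements of supported sets of a circuit meet both sign classes. -/
theorem IsAffineCircuit.isSupported_iff {ι : Type*} [Fintype ι] {w : ι → V} {c : ι → ℝ}
    (h : IsAffineCircuit w c) {I : Set ι} :
    IsSupported w I ↔ I = univ ∨ ((∃ i, i ∉ I ∧ 0 < c i) ∧ ∃ i, i ∉ I ∧ c i < 0) := by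
  classical
  constructor
  · rintro ⟨l, M, hl⟩
    by_cases hI : I = univ
    · exact Or.inl hI
    right
    obtain ⟨k, hk⟩ := (Set.ne_univ_iff_exists_notMem I).1 hI
    have hsum : ∑ i, c i * (M - l (w i)) = 0 := by
      have h1 : ∑ i, c i * l (w i) = 0 := by
        simpa [map_sum] using congrArg l h.sum_smul_eq_zero
      simp only [mul_sub, Finset.sum_sub_distrib, ← Finset.sum_mul, h.sum_eq_zero, h1]
      simp
    have hpos : ∀ i, i ∉ I → 0 < M - l (w i) := fun i hi =>
      sub_pos.2 (lt_of_le_of_ne (hl i).1 fun he => hi ((hl i).2.1 he))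
    have hzero : ∀ i, i ∈ I → M - l (w i) = 0 := fun i hi => by rw [(hl i).2.2 hi, sub_self]
    constructor
    · by_contra! hc
      refine absurd hsum (ne_of_lt (Finset.sum_neg' (fun i _ => ?_) ⟨k, Finset.mem_univ k, ?_⟩))
      · by_cases hi : i ∈ I
        · rw [hzero i hi, mul_zero]
        · exact mul_nonpos_of_nonpos_of_nonneg (hc i hi) (hpos i hi).le
      · exact mul_neg_of_neg_of_pos (lt_of_le_of_ne (hc k hk) (h.ne_zero k)) (hpos k hk)
    · by_contra! hc
      refine absurd hsum (ne_of_gt (Finset.sum_pos' (fun i _ => ?_) ⟨k, Finset.mem_univ k, ?_⟩))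
      · by_cases hi : i ∈ I
        · rw [hzero i hi, mul_zero]
        · exact mul_nonneg (hc i hi) (hpos i hi).le
      · exact mul_pos (lt_of_le_of_ne (hc k hk) (h.ne_zero k).symm) (hpos k hk)
  · rintro (rfl | ⟨⟨i, hi, hci⟩, j, hj, hcj⟩)
    · exact ⟨0, 0, fun i => by simp⟩
    · set A : Finset ι := {k | k ∉ I ∧ 0 < c k} with hA
      set B : Finset ι := {k | k ∉ I ∧ c k < 0} with hB
      have hAc : (0 : ℝ) < A.card := by
        exact_mod_cast Finset.card_pos.2 ⟨i, by simp [hA, hi, hci]⟩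
      have hBc : (0 : ℝ) < B.card := by
        exact_mod_cast Finset.card_pos.2 ⟨j, by simp [hB, hj, hcj]⟩
      set ψ : ι → ℝ := fun k =>
        (if k ∈ A then (c k * A.card)⁻¹ else 0) + if k ∈ B then -(c k * B.card)⁻¹ else 0 with hψ
      have hsum : ∑ k, c k * ψ k = 0 := by
        have e : ∀ k, c k * ψ k =
            (if k ∈ A then (A.card : ℝ)⁻¹ else 0) + if k ∈ B then -(B.card : ℝ)⁻¹ else 0 := by
          intro k
          have := h.ne_zero k
          simp only [hψ]
          split_ifs <;> field_simp <;> simp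
        simp only [e, Finset.sum_add_distrib, Finset.sum_ite_mem, Finset.univ_inter,
          Finset.sum_const, nsmul_eq_mul]
        field_simp
        simp
      have hψI : ∀ k, k ∈ I → ψ k = 0 := fun k hk => by simp [hψ, hA, hB, hk]
      have hψn : ∀ k, k ∉ I → 0 < ψ k := by
        intro k hk
        rcases lt_or_gt_of_ne (h.ne_zero k) with hc | hc
        · have : ψ k = -(c k * B.card)⁻¹ := by simp [hψ, hA, hB, hk, hc, hc.le]
          rw [this, ← inv_neg]
          exact inv_pos.2 (by nlinarith)
        · have : ψ k = (c k * A.card)⁻¹ := by simp [hψ, hA, hB, hk, hc, hc.le]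
          rw [this]
          positivity
      obtain ⟨l, M, hl⟩ := h.exists_functional ψ hsum
      refine ⟨l, M, fun k => ?_⟩
      rw [hl k]
      by_cases hk : k ∈ I
      · simp [hψI k hk, hk]
      · have := hψn k hk
        refine ⟨by linarith, fun he => by linarith, fun h' => absurd h' hk⟩

theorem IsAffineCircuit.not_affineIndependent {ι : Type*} [Fintype ι] {w : ι → V} {c : ι → ℝ}
    (h : IsAffineCircuit w c) (i : ι) : ¬ AffineIndependent ℝ w := fun hw =>
  h.ne_zero i (affineIndependent_iff.1 hw Finset.univ c h.sum_eq_zero h.sum_smul_eq_zero i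
    (Finset.mem_univ i))

/-- A family satisfying a circuit all of whose members are vertices of its convex hull does not
span a simplex. -/
theorem IsAffineCircuit.not_isSimplex {ι : Type*} [Fintype ι] {w : ι → V} {c : ι → ℝ}
    (h : IsAffineCircuit w c) (i₀ : ι) (hs : ∀ i, IsSupported w {i}) :
    ¬ IsSimplex (convexHull ℝ (range w)) := by
  rintro ⟨S, -, hS, hSe⟩
  have hmem : ∀ i, w i ∈ S := by
    intro i
    have hface : IsFaceOf {w i} (convexHull ℝ (range w)) :=
      isFaceOf_convexHull_range_iff.2 ⟨{i}, hs i, by simp⟩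
    have := isExtreme_singleton.1 (IsExposed.isExtreme hface)
    rw [hSe] at this
    exact extremePoints_convexHull_subset this
  have hinj : Function.Injective w := by
    intro i j hij
    have := (hs j).mem_convexHull_image_iff (i := i)
    rw [hij] at this
    simpa using this.1 (subset_convexHull ℝ _ (by simp))
  refine h.not_affineIndependent i₀ ?_
  exact hS.comp_embedding
    ⟨fun i => ⟨w i, hmem i⟩, fun i j hij => hinj (congrArg Subtype.val hij)⟩

/-! ### Slicing off a vertex -/

/-- The point of the line through `a` and `b` at which the functional `g` takes the value `d`. -/
noncomputable def slicePoint (g : V →L[ℝ] ℝ) (d : ℝ) (a b : V) : V :=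
  AffineMap.lineMap a b ((g a - d) / (g a - g b))

theorem apply_slicePoint {g : V →L[ℝ] ℝ} {d : ℝ} {a b : V} (h : g b < d) (h' : d < g a) :
    g (slicePoint g d a b) = d := by
  have : g a - g b ≠ 0 := by linarith
  simp only [slicePoint, AffineMap.lineMap_apply_module, map_add, map_smul, smul_eq_mul]
  field_simp
  ring

theorem sep_convexHull_insert_eq {κ : Type*} [Fintype κ] [Nonempty κ] {g : V →L[ℝ] ℝ} {d : ℝ}
    {a : V} {w : κ → V} (h : ∀ k, g (w k) < d) (h' : d < g a) :
    {x ∈ convexHull ℝ (insert a (range w)) | g x = d} =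
      convexHull ℝ (range fun k => slicePoint g d a (w k)) := by
  ext x
  constructor
  · rintro ⟨hx, hxd⟩
    rw [convexHull_insert (range_nonempty w), convexJoin_singleton_left, mem_iUnion₂] at hx
    obtain ⟨y, hy, hx⟩ := hx
    obtain ⟨b, hb, hb', rfl⟩ := mem_convexHull_range_iff.1 hy
    obtain ⟨r, t, hr, ht, hrt, rfl⟩ := hx
    have hsum : r * g a + t * ∑ k, b k * g (w k) = d := by
      simpa [map_sum] using hxd
    have hga : 0 < g a - d := by linarith
    have hgk : ∀ k, 0 < g a - g (w k) := fun k => by linarith [h k]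
    have hcoef : ∑ k, b k * (g a - g (w k)) = g a - ∑ k, b k * g (w k) := by
      simp only [mul_sub, Finset.sum_sub_distrib, ← Finset.sum_mul, hb', one_mul]
    have hone : ∑ k, t * b k * (g a - g (w k)) / (g a - d) = 1 := by
      rw [← Finset.sum_div, div_eq_one_iff_eq hga.ne']
      simp only [mul_assoc, ← Finset.mul_sum]
      rw [hcoef]
      have : r = 1 - t := by linarith
      subst this
      linarith
    refine mem_convexHull_range_iff.2 ⟨fun k => t * b k * (g a - g (w k)) / (g a - d),
      fun k => div_nonneg (mul_nonneg (mul_nonneg ht (hb k)) (hgk k).le) hga.le, hone, ?_⟩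
    have e : ∀ k, (t * b k * (g a - g (w k)) / (g a - d)) • slicePoint g d a (w k) =
        (t * b k * (g a - g (w k)) / (g a - d)) • a - (t * b k) • a + (t * b k) • w k := by
      intro k
      have := (hgk k).ne'
      have h2 := hga.ne'
      simp only [slicePoint, AffineMap.lineMap_apply_module]
      match_scalars <;> field_simp
    simp only [e, Finset.sum_add_distrib, Finset.sum_sub_distrib, ← Finset.sum_smul, hone,
      ← Finset.mul_sum, hb', Finset.smul_sum, smul_smul]
    obtain rfl : r = 1 - t := by linarith
    module
  · intro hx
    refine ⟨?_, eq_of_mem_convexHull ?_ hx⟩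
    · refine convexHull_min ?_ (convex_convexHull ℝ _) hx
      rintro _ ⟨k, rfl⟩
      refine (convex_convexHull ℝ _).lineMap_mem (subset_convexHull ℝ _ (mem_insert _ _))
        (subset_convexHull ℝ _ (mem_insert_of_mem _ (mem_range_self k))) ⟨?_, ?_⟩
      · exact div_nonneg (by linarith) (by linarith [h k])
      · exact div_le_one_of_le₀ (by linarith [h k]) (by linarith [h k])
    · rintro _ ⟨k, rfl⟩
      exact apply_slicePoint (h k) h'

/-- Slicing off one member of a circuit yields a circuit with the same signs. -/
theorem IsAffineCircuit.slice {n : ℕ} {w : Fin (n + 1) → V} {c : Fin (n + 1) → ℝ}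
    (hw : IsAffineCircuit w c) (i : Fin (n + 1)) {g : V →L[ℝ] ℝ} {d : ℝ}
    (h : ∀ k, g (w (i.succAbove k)) < d) (h' : d < g (w i)) :
    IsAffineCircuit (fun k => slicePoint g d (w i) (w (i.succAbove k)))
      (fun k => c (i.succAbove k) * ((g (w i) - g (w (i.succAbove k))) / (g (w i) - d))) := by
  have hga : g (w i) - d ≠ 0 := by linarith
  have hgk : ∀ k, g (w i) - g (w (i.succAbove k)) ≠ 0 := fun k => by linarith [h k]
  have s0 := hw.sum_eq_zero
  have s1 := hw.sum_smul_eq_zero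
  rw [Fin.sum_univ_succAbove _ i] at s0 s1
  have s2 : c i * g (w i) + ∑ k, c (i.succAbove k) * g (w (i.succAbove k)) = 0 := by
    simpa [map_sum] using congrArg g s1
  have hs : ∑ k, c (i.succAbove k) *
      ((g (w i) - g (w (i.succAbove k))) / (g (w i) - d)) = 0 := by
    simp only [← mul_div_assoc]
    rw [← Finset.sum_div, div_eq_zero_iff]
    left
    simp only [mul_sub, Finset.sum_sub_distrib, ← Finset.sum_mul]
    linear_combination g (w i) * s0 - s2
  refine ⟨fun k => mul_ne_zero (hw.ne_zero _) (div_ne_zero (hgk k) hga), hs, ?_, ?_⟩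
  · have e : ∀ k, (c (i.succAbove k) * ((g (w i) - g (w (i.succAbove k))) / (g (w i) - d))) •
        slicePoint g d (w i) (w (i.succAbove k)) =
        (c (i.succAbove k) * ((g (w i) - g (w (i.succAbove k))) / (g (w i) - d))) • w i -
          c (i.succAbove k) • w i + c (i.succAbove k) • w (i.succAbove k) := by
      intro k
      have := hgk k
      simp only [slicePoint, AffineMap.lineMap_apply_module]
      match_scalars <;> field_simp
    simp only [e, Finset.sum_add_distrib, Finset.sum_sub_distrib, ← Finset.sum_smul, hs]
    rw [zero_smul, eq_neg_of_add_eq_zero_right s0, zero_sub, neg_smul, neg_neg]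
    exact s1
  · intro ψ hψ
    obtain ⟨l, M, hl⟩ := hw.exists_functional
      (i.insertNth 0 fun k => ψ k * ((g (w i) - g (w (i.succAbove k))) / (g (w i) - d))) (by
        rw [Fin.sum_univ_succAbove _ i]
        refine Eq.trans ?_ hψ
        simp only [Fin.insertNth_apply_same, Fin.insertNth_apply_succAbove, mul_zero, zero_add]
        exact Finset.sum_congr rfl fun k _ => by ring)
    refine ⟨l, M, fun k => ?_⟩
    have hi := hl i
    have hk := hl (i.succAbove k)
    have := hgk k
    simp only [Fin.insertNth_apply_same, Fin.insertNth_apply_succAbove] at hi hk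
    simp only [slicePoint, AffineMap.lineMap_apply_module, map_add, map_smul, smul_eq_mul, hi, hk]
    field_simp
    ring

theorem slicePoint_ne {g l : V →L[ℝ] ℝ} {d : ℝ} {a b b' : V} (hd : d < g a) (hb' : g b' < d)
    (h : l b = l a) (h' : l b' < l a) : slicePoint g d a b ≠ slicePoint g d a b' := by
  intro he
  have := congrArg l he
  simp only [slicePoint, AffineMap.lineMap_apply_module, map_add, map_smul, smul_eq_mul, h] at this
  have hpos : 0 < (g a - d) / (g a - g b') := div_pos (by linarith) (by linarith)
  nlinarith

/-! ### Conic sequences given by an ordering of the vertices -/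

/-- Removing the vertices in the order `v ℓ, v (ℓ - 1), …`, the faces `J i` being the cones. -/
def ConicSeq.ofIndices {ι : Type*} [Fintype ι] (w : ι → V) (ℓ : ℕ) (hℓ : 1 ≤ ℓ) (v : ℕ → ι)
    (J : ℕ → Set ι) (hw : ∀ i, IsSupported w {i})
    (hinj : ∀ i k, 1 ≤ i → i < k → k ≤ ℓ → v k ≠ v i) (hsurj : ∀ j, ∃ i, 1 ≤ i ∧ i ≤ ℓ ∧ v i = j)
    (hJ : ∀ i, 2 ≤ i → i ≤ ℓ → IsSupported w (J i))
    (hJv : ∀ i k, 2 ≤ i → i < k → k ≤ ℓ → v k ∉ J i) (hvJ : ∀ i, 2 ≤ i → i ≤ ℓ → v i ∈ J i)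
    (hmax : ∀ i, 2 ≤ i → i ≤ ℓ → ∀ I, IsSupported w I → (∀ k, i < k → k ≤ ℓ → v k ∉ I) →
      v i ∈ I → I ⊆ J i) :
    ConicSeq (faces (convexHull ℝ (range w))) ℓ where
  cpx i := {F | ∃ I, IsSupported w I ∧ (∀ k, i < k → k ≤ ℓ → v k ∉ I) ∧ F = convexHull ℝ (w '' I)}
  v i := w (v i)
  E i := convexHull ℝ (w '' J i)
  one_le := hℓ
  top := by
    ext F
    refine Iff.trans ?_ isFaceOf_convexHull_range_iff.symm
    exact ⟨fun ⟨I, hI, _, hF⟩ => ⟨I, hI, hF⟩,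
      fun ⟨I, hI, hF⟩ => ⟨I, hI, fun k hk hk' => absurd hk (by omega), hF⟩⟩
  bottom := by
    ext F
    constructor
    · rintro ⟨I, hI, hv, rfl⟩
      have hsub : I ⊆ {v 1} := by
        intro j hj
        obtain ⟨i, hi, hi', rfl⟩ := hsurj j
        rcases hi.eq_or_lt with rfl | h1
        · rfl
        · exact absurd hj (hv i h1 hi')
      rcases subset_singleton_iff_eq.1 hsub with rfl | rfl <;> simp
    · rintro (rfl | rfl)
      · exact ⟨∅, ⟨0, 1, fun i => by simp⟩, by simp, by simp⟩
      · exact ⟨{v 1}, hw _, fun k hk hk' => hinj 1 k le_rfl hk hk', by simp⟩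
  vtx_mem i hi hi' := ⟨{v i}, hw _, fun k hk hk' => hinj i k (by omega) hk hk', by simp⟩
  E_mem i hi hi' := ⟨J i, hJ i hi hi', fun k hk hk' => hJv i k hi hk hk', rfl⟩
  v_mem_E i hi hi' := subset_convexHull ℝ _ (mem_image_of_mem w (hvJ i hi hi'))
  E_greatest := by
    rintro i hi hi' _ ⟨I, hI, hv, rfl⟩ hvI
    exact convexHull_mono (image_mono
      (hmax i hi hi' I hI hv (hI.mem_convexHull_image_iff.1 hvI)))
  step := by
    intro i hi hi'
    ext F
    constructor
    · rintro ⟨I, hI, hv, rfl⟩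
      refine ⟨⟨I, hI, fun k hk hk' => hv k (by omega) hk', rfl⟩, fun h => ?_⟩
      exact hv i (by omega) hi' (hI.mem_convexHull_image_iff.1 h.2.1)
    · rintro ⟨⟨I, hI, hv, rfl⟩, h⟩
      refine ⟨I, hI, fun k hk hk' => ?_, rfl⟩
      rcases (show i ≤ k by omega).eq_or_lt with rfl | h1
      · intro hkI
        exact h ⟨⟨I, hI, hv, rfl⟩, hI.mem_convexHull_image_iff.2 hkI,
          convexHull_mono (image_mono (hmax i hi hi' I hI hv hkI))⟩
      · exact hv k h1 hk'

theorem IsSupported.exists_separation {ι : Type*} [Finite ι] {w : ι → V} {i : ι}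
    (h : IsSupported w {i}) :
    ∃ (g : V →L[ℝ] ℝ) (d : ℝ), d < g (w i) ∧ ∀ j, j ≠ i → g (w j) < d := by
  obtain ⟨l, M, hl⟩ := h
  have hM : l (w i) = M := (hl i).2.2 rfl
  have hlt : ∀ j, j ≠ i → l (w j) < M := fun j hj =>
    lt_of_le_of_ne (hl j).1 fun he => hj ((hl j).2.1 he)
  have : ∀ᶠ d in nhdsWithin M (Iio M), ∀ j, j ≠ i → l (w j) < d := by
    refine Filter.eventually_all.2 fun j => ?_
    by_cases hj : j = i
    · exact Filter.Eventually.of_forall fun d h => absurd hj h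
    · filter_upwards [nhdsWithin_le_nhds (lt_mem_nhds (hlt j hj))] with d hd _ using hd
  obtain ⟨d, hd, hdM⟩ := (this.and self_mem_nhdsWithin).exists
  exact ⟨l, d, by rw [hM]; exact hdM, hd⟩

/-- A functional separating a vertex from all others yields the slice at a cone over it. -/
theorem isConeSlice_of_separation {ι κ : Type*} [Fintype κ] [Nonempty κ] {w : ι → V}
    {i : ι} {J : Set ι} {e : κ → ι} (hJ : J = insert i (range e)) (he : ∀ k, e k ≠ i)
    {g : V →L[ℝ] ℝ} {d : ℝ} (hd : d < g (w i)) (hg : ∀ j, j ≠ i → g (w j) < d)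
    {K : Set (Set V)} (hK : ∀ F ∈ K, ∃ I : Set ι, i ∉ I ∧ F = convexHull ℝ (w '' I)) :
    IsConeSlice (convexHull ℝ (range fun k => slicePoint g d (w i) (w (e k))))
      (convexHull ℝ (w '' J)) (w i) (⋃₀ K) := by
  refine ⟨g, d, hd, ?_, ?_⟩
  · rintro x ⟨⟨F, hF, hx⟩, -⟩
    obtain ⟨I, hI, rfl⟩ := hK F hF
    refine lt_of_mem_convexHull ?_ hx
    rintro _ ⟨j, hj, rfl⟩
    exact hg j fun h => hI (h ▸ hj)
  · rw [hJ, image_insert_eq, ← range_comp]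
    exact (sep_convexHull_insert_eq (fun k => hg _ (he k)) hd).symm

/-! ### The square -/

/-- The vertices of the unit square, as two pairs of opposite vertices. -/
def squareVertex : Fin 4 → Fin 2 → ℝ := ![![0, 0], ![1, 1], ![1, 0], ![0, 1]]

theorem convexHull_range_squareVertex :
    convexHull ℝ (range squareVertex) = Icc (0 : Fin 2 → ℝ) 1 := by
  apply Subset.antisymm
  · refine convexHull_min ?_ (convex_Icc _ _)
    rintro _ ⟨k, rfl⟩
    fin_cases k <;> constructor <;> intro j <;> fin_cases j <;> simp [squareVertex]
  · rintro x ⟨h0, h1⟩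
    have a0 := h0 0
    have a1 := h0 1
    have b0 := h1 0
    have b1 := h1 1
    simp only [Pi.zero_apply, Pi.one_apply] at a0 a1 b0 b1
    refine mem_convexHull_range_iff.2
      ⟨![(1 - x 0) * (1 - x 1), x 0 * x 1, x 0 * (1 - x 1), (1 - x 0) * x 1], ?_, ?_, ?_⟩
    · intro k
      fin_cases k <;> simp <;> apply mul_nonneg <;> linarith
    · simp [Fin.sum_univ_four]
      ring
    · ext j
      fin_cases j <;> simp [Fin.sum_univ_four, squareVertex] <;> ring

theorem isAffineCircuit_squareVertex : IsAffineCircuit squareVertex ![-1, -1, 1, 1] where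
  ne_zero i := by fin_cases i <;> simp
  sum_eq_zero := by simp [Fin.sum_univ_four]
  sum_smul_eq_zero := by
    ext j
    fin_cases j <;> simp [Fin.sum_univ_four, squareVertex]
  exists_functional ψ hψ := by
    simp [Fin.sum_univ_four] at hψ
    refine ⟨(ψ 0 - ψ 2) • ContinuousLinearMap.proj 0 + (ψ 0 - ψ 3) • ContinuousLinearMap.proj 1,
      ψ 0, fun i => ?_⟩
    fin_cases i <;> simp [squareVertex]
    linarith

/-- A quadrilateral is combinatorially a square. -/
theorem IsAffineCircuit.isCombCube {w : Fin 4 → V} {c : Fin 4 → ℝ} (h : IsAffineCircuit w c)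
    (hpos : ∀ i, 0 < c i ↔ 2 ≤ i) (hneg : ∀ i, c i < 0 ↔ i < 2) :
    IsCombCube (convexHull ℝ (range w)) 2 := by
  unfold IsCombCube
  rw [← convexHull_range_squareVertex]
  refine nonempty_faces_orderIso fun I => ?_
  rw [h.isSupported_iff, isAffineCircuit_squareVertex.isSupported_iff]
  have hp : ∀ i, (0 : ℝ) < (![-1, -1, 1, 1] : Fin 4 → ℝ) i ↔ 2 ≤ i := by
    intro i; fin_cases i <;> simp
  have hn : ∀ i, (![-1, -1, 1, 1] : Fin 4 → ℝ) i < 0 ↔ i < 2 := by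
    intro i; fin_cases i <;> simp
  simp only [hpos, hneg, hp, hn]

/-! ### The triangular bipyramid -/

theorem exists_pos_weights_of_mem_intrinsicInterior {ι : Type*} [Fintype ι] {T : ι → V}
    (hT : AffineIndependent ℝ T) {x : V} (hx : x ∈ intrinsicInterior ℝ (convexHull ℝ (range T))) :
    ∃ a : ι → ℝ, (∀ i, 0 < a i) ∧ ∑ i, a i = 1 ∧ ∑ i, a i • T i = x := by
  classical
  obtain ⟨a, ha, ha', hax⟩ := mem_convexHull_range_iff.1 (intrinsicInterior_subset hx)
  refine ⟨a, fun i => (ha i).lt_of_ne' fun hi => ?_, ha', hax⟩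
  obtain ⟨y, hy, rfl⟩ := mem_intrinsicInterior.1 hx
  have hTi : T i ∈ affineSpan ℝ (convexHull ℝ (range T)) :=
    subset_affineSpan ℝ _ (subset_convexHull ℝ _ (mem_range_self i))
  let γ : ℝ → affineSpan ℝ (convexHull ℝ (range T)) := fun ε =>
    ⟨AffineMap.lineMap (y : V) (T i) (-ε), AffineMap.lineMap_mem _ y.2 hTi⟩
  have hγ : Continuous γ := by
    refine Continuous.subtype_mk ?_ _
    simp only [AffineMap.lineMap_apply_module]
    fun_prop
  have hγ0 : γ 0 = y := by
    ext1
    simp [γ]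
  have hev : ∀ᶠ ε in nhdsWithin (0 : ℝ) (Ioi 0), γ ε ∈ interior
      ((↑) ⁻¹' convexHull ℝ (range T) : Set (affineSpan ℝ (convexHull ℝ (range T)))) :=
    nhdsWithin_le_nhds (hγ.continuousAt.eventually_mem
      (isOpen_interior.mem_nhds (by rw [hγ0]; exact hy)))
  obtain ⟨ε, hε, hε0⟩ := (hev.and self_mem_nhdsWithin).exists
  have hmem : AffineMap.lineMap (y : V) (T i) (-ε) ∈ convexHull ℝ (range T) := by
    have := interior_subset hε
    exact this
  obtain ⟨b, hb, hb', hbx⟩ := mem_convexHull_range_iff.1 hmem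
  have h1 : ∑ j, ((1 + ε) * a j - (if j = i then ε else 0) - b j) = 0 := by
    simp [Finset.sum_sub_distrib, ← Finset.mul_sum, ha', hb']
  have h2 : ∑ j, ((1 + ε) * a j - (if j = i then ε else 0) - b j) • T j = 0 := by
    simp only [sub_smul, Finset.sum_sub_distrib, mul_smul, ← Finset.smul_sum, hax, hbx,
      AffineMap.lineMap_apply_module, ite_smul, zero_smul, Finset.sum_ite_eq', Finset.mem_univ,
      if_true]
    module
  have h3 := affineIndependent_iff.1 hT Finset.univ _ h1 h2 i (Finset.mem_univ i)
  have h4 : 0 < ε := hε0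
  have := hb i
  simp only [hi, if_true, mul_zero] at h3
  linarith

theorem AffineIndependent.exists_functional {V : Type*} [NormedAddCommGroup V] [NormedSpace ℝ V]
    [FiniteDimensional ℝ V] {t₀ t₁ t₂ : V} (h : AffineIndependent ℝ ![t₀, t₁, t₂]) (a b : ℝ) :
    ∃ l : V →L[ℝ] ℝ, l (t₁ - t₀) = a ∧ l (t₂ - t₀) = b := by
  have hli : LinearIndependent ℝ ![t₁ - t₀, t₂ - t₀] := by
    rw [LinearIndependent.pair_iff]
    intro r s hrs
    have h1 := affineIndependent_iff.1 h Finset.univ ![-r - s, r, s]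
      (by simp only [Fin.sum_univ_three, Matrix.cons_val]; ring) (by
        simp only [Fin.sum_univ_three, Matrix.cons_val]
        rw [← hrs]
        module)
    exact ⟨h1 1 (Finset.mem_univ _), h1 2 (Finset.mem_univ _)⟩
  let B := Module.Basis.span hli
  obtain ⟨l, hl⟩ := LinearMap.exists_extend (B.constr ℝ ![a, b])
  refine ⟨LinearMap.toContinuousLinearMap l, ?_, ?_⟩
  · have := B.constr_basis ℝ ![a, b] 0
    rw [← hl] at this
    simpa [B, Module.Basis.span_apply] using this
  · have := B.constr_basis ℝ ![a, b] 1
    rw [← hl] at this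
    simpa [B, Module.Basis.span_apply] using this

theorem exists_isAffineCircuit_bipyramid {V : Type*} [NormedAddCommGroup V] [NormedSpace ℝ V]
    [FiniteDimensional ℝ V] {t₀ t₁ t₂ p q : V} (htri : AffineIndependent ℝ ![t₀, t₁, t₂])
    {f : V →L[ℝ] ℝ} {c : ℝ} (h₀ : f t₀ = c) (h₁ : f t₁ = c) (h₂ : f t₂ = c) (hp : c < f p)
    (hcross : ∃ x ∈ openSegment ℝ p q, x ∈ intrinsicInterior ℝ (convexHull ℝ {t₀, t₁, t₂})) :
    ∃ b : Fin 5 → ℝ, IsAffineCircuit ![t₀, t₁, t₂, p, q] b ∧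
      (∀ i, 0 < b i ↔ 3 ≤ i) ∧ ∀ i, b i < 0 ↔ i < 3 := by
  obtain ⟨x, ⟨r, s, hr, hs, hrs, hx⟩, hxi⟩ := hcross
  have hrange : ({t₀, t₁, t₂} : Set V) = range ![t₀, t₁, t₂] := by
    ext y
    simp [eq_comm]
    tauto
  rw [hrange] at hxi
  obtain ⟨a, ha, ha', hax⟩ := exists_pos_weights_of_mem_intrinsicInterior htri hxi
  have a0 := ha 0
  have a1 := ha 1
  have a2 := ha 2
  simp only [Fin.sum_univ_three, Matrix.cons_val] at ha' hax
  refine ⟨![-a 0, -a 1, -a 2, r, s], ⟨?_, ?_, ?_, ?_⟩, ?_, ?_⟩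
  · intro i
    fin_cases i <;> simp [a0.ne', a1.ne', a2.ne', hr.ne', hs.ne']
  · simp only [Fin.sum_univ_five, Matrix.cons_val]
    linarith
  · simp only [Fin.sum_univ_five, Matrix.cons_val]
    rw [← hax] at hx
    rw [← sub_eq_zero.2 hx]
    module
  · intro ψ hψ
    simp only [Fin.sum_univ_five, Matrix.cons_val] at hψ
    obtain ⟨l, hl1, hl2⟩ := htri.exists_functional (ψ 0 - ψ 1) (ψ 0 - ψ 2)
    rw [map_sub] at hl1 hl2
    obtain ⟨β, hβ⟩ : ∃ β : ℝ, l p - l t₀ + β * (f p - c) = ψ 0 - ψ 3 :=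
      ⟨(ψ 0 - ψ 3 - (l p - l t₀)) / (f p - c), by
        have : f p - c ≠ 0 := by linarith
        field_simp
        ring⟩
    have el := congrArg l (hx.trans hax.symm)
    have ef := congrArg f (hx.trans hax.symm)
    simp only [map_add, map_smul, smul_eq_mul, h₀, h₁, h₂] at el ef
    refine ⟨l + β • f, l t₀ + β * c + ψ 0, fun i => ?_⟩
    fin_cases i <;> simp [h₀, h₁, h₂]
    · linarith
    · linarith
    · linarith
    · refine mul_left_cancel₀ hs.ne' ?_
      linear_combination el + β * ef + hψ - r * hβ + a 1 * hl1 + a 2 * hl2 +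
        (l t₀ + β * c + ψ 0) * (ha' - hrs)
  · intro i
    fin_cases i <;> simp [a0.le, a1.le, a2.le, hr, hs]
  · intro i
    fin_cases i <;> simp [a0, a1, a2, hr.le, hs.le]

theorem IsAffineCircuit.isSupported_bipyramid_iff {w : Fin 5 → V} {b : Fin 5 → ℝ}
    (h : IsAffineCircuit w b) (hpos : ∀ i, 0 < b i ↔ 3 ≤ i) (hneg : ∀ i, b i < 0 ↔ i < 3)
    {I : Set (Fin 5)} :
    IsSupported w I ↔ I = univ ∨ ((∃ i, i ∉ I ∧ 3 ≤ i) ∧ ∃ i, i ∉ I ∧ i < 3) := by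
  simp only [h.isSupported_iff, hpos, hneg]

/-- The order of the vertices in a conic sequence of the bipyramid. -/
def bipyramidVertex : ℕ → Fin 5
  | 5 => 0
  | 4 => 3
  | 3 => 4
  | 2 => 1
  | _ => 2

/-- The vertex sets of the cones in a conic sequence of the bipyramid. -/
def bipyramidCone : ℕ → Set (Fin 5)
  | 5 => univ
  | 4 => {1, 2, 3}
  | 3 => {1, 2, 4}
  | _ => {1, 2}

theorem IsAffineCircuit.exists_conicSeq_bipyramid {w : Fin 5 → V} {b : Fin 5 → ℝ}
    (h : IsAffineCircuit w b) (hpos : ∀ i, 0 < b i ↔ 3 ≤ i) (hneg : ∀ i, b i < 0 ↔ i < 3) :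
    ∃ (cs : ConicSeq (faces (convexHull ℝ (range w))) 5) (C : ℕ → Set V), cs.HasSlices C ∧
      (∃ w, C 2 = {w}) ∧ IsSegment (C 3) ∧ IsSegment (C 4) ∧ IsCombCube (C 5) 2 := by
  have hS : ∀ {I : Set (Fin 5)}, IsSupported w I ↔
      I = univ ∨ ((∃ i, i ∉ I ∧ 3 ≤ i) ∧ ∃ i, i ∉ I ∧ i < 3) :=
    h.isSupported_bipyramid_iff hpos hneg
  have hsing : ∀ i, IsSupported w {i} := by
    intro i
    refine hS.2 (Or.inr ?_)
    simp only [mem_singleton_iff]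
    revert i
    decide
  have hJ : ∀ i, 2 ≤ i → i ≤ 5 → IsSupported w (bipyramidCone i) := by
    intro i hi hi'
    interval_cases i
    · exact hS.2 (Or.inr ⟨⟨3, by simp [bipyramidCone]⟩, ⟨0, by simp [bipyramidCone]⟩⟩)
    · exact hS.2 (Or.inr ⟨⟨3, by simp [bipyramidCone]⟩, ⟨0, by simp [bipyramidCone]⟩⟩)
    · exact hS.2 (Or.inr ⟨⟨4, by simp [bipyramidCone]⟩, ⟨0, by simp [bipyramidCone]⟩⟩)
    · exact hS.2 (Or.inl rfl)
  have hmax : ∀ i, 2 ≤ i → i ≤ 5 → ∀ I, IsSupported w I →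
      (∀ k, i < k → k ≤ 5 → bipyramidVertex k ∉ I) → bipyramidVertex i ∈ I →
      I ⊆ bipyramidCone i := by
    intro i hi hi' I hI hk hiI j hj
    by_cases hI₁ : I = univ
    · subst hI₁
      rcases hi'.eq_or_lt with rfl | h5
      · trivial
      · exact absurd (mem_univ _) (hk 5 h5 le_rfl)
    obtain ⟨⟨m, hm, hm'⟩, -⟩ := (hS.1 hI).resolve_left hI₁
    have h34 : 3 ∈ I → 4 ∉ I := by
      have : m = 3 ∨ m = 4 := by
        clear hm
        revert m
        decide
      rcases this with rfl | rfl
      exacts [fun h => absurd h hm, fun _ => hm]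
    clear hm hm' hsing hJ
    have hk₅ := hk 5
    have hk₄ := hk 4
    have hk₃ := hk 3
    interval_cases i <;> fin_cases j <;>
      simp_all [bipyramidVertex, bipyramidCone]
  let cs : ConicSeq (faces (convexHull ℝ (range w))) 5 :=
    ConicSeq.ofIndices w 5 (by norm_num) bipyramidVertex bipyramidCone hsing
      (by
        intro i k hi hik hk
        interval_cases k <;> interval_cases i <;> decide)
      (by
        intro j
        fin_cases j
        exacts [⟨5, by decide⟩, ⟨2, by decide⟩, ⟨1, by decide⟩, ⟨4, by decide⟩, ⟨3, by decide⟩])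
      hJ
      (by
        intro i k hi hik hk
        interval_cases k <;> interval_cases i <;> simp [bipyramidVertex, bipyramidCone])
      (by
        intro i hi hi'
        interval_cases i <;> simp [bipyramidVertex, bipyramidCone])
      hmax
  have hK : ∀ i, 2 ≤ i → i ≤ 5 → ∀ F ∈ cs.cpx (i - 1),
      ∃ I, bipyramidVertex i ∉ I ∧ F = convexHull ℝ (w '' I) := by
    rintro i hi hi' F ⟨I, _, hv, hF⟩
    exact ⟨I, hv i (by omega) hi', hF⟩
  have hslice : ∀ i, 2 ≤ i → i ≤ 5 → ∀ {n : ℕ} (e : Fin (n + 1) → Fin 5),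
      bipyramidCone i = insert (bipyramidVertex i) (range e) →
      (∀ k, e k ≠ bipyramidVertex i) →
      ∃ (g : V →L[ℝ] ℝ) (d : ℝ), d < g (w (bipyramidVertex i)) ∧
        (∀ j, j ≠ bipyramidVertex i → g (w j) < d) ∧
        IsConeSlice (convexHull ℝ
          (range fun k => slicePoint g d (w (bipyramidVertex i)) (w (e k))))
          (cs.E i) (cs.v i) (⋃₀ cs.cpx (i - 1)) := by
    intro i hi hi' n e he he'
    obtain ⟨g, d, hd, hg⟩ := (hsing (bipyramidVertex i)).exists_separation
    exact ⟨g, d, hd, hg, isConeSlice_of_separation he he' hd hg (hK i hi hi')⟩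
  have hsegment : ∀ (g : V →L[ℝ] ℝ) (d : ℝ) (i : Fin 5), 3 ≤ i → d < g (w i) →
      (∀ j, j ≠ i → g (w j) < d) →
      IsSegment (convexHull ℝ (range fun k => slicePoint g d (w i) (w (![1, 2] k)))) := by
    intro g d i hi hd hg
    refine ⟨slicePoint g d (w i) (w 1), slicePoint g d (w i) (w 2), ?_, ?_⟩
    · obtain ⟨l, M, hl⟩ : IsSupported w {i, 1} := by
        refine hS.2 (Or.inr ?_)
        simp only [mem_insert_iff, mem_singleton_iff]
        clear hd hg
        revert i
        decide
      have hi2 : (2 : Fin 5) ≠ i := by rintro rfl; exact absurd hi (by decide)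
      have h1 : l (w 1) = M := (hl 1).2.2 (by simp)
      have h2 : l (w i) = M := (hl i).2.2 (by simp)
      refine slicePoint_ne hd (hg 2 hi2) (l := l) (h1.trans h2.symm) ?_
      rw [h2]
      refine lt_of_le_of_ne (hl 2).1 fun he => ?_
      have := (hl 2).2.1 he
      simp [hi2] at this
    · rw [← convexHull_pair]
      congr 1
      ext y
      simp [eq_comm]
  obtain ⟨g₅, d₅, hd₅, hg₅, hs₅⟩ := hslice 5 (by norm_num) le_rfl (Fin.succAbove 0)
    (by ext j; fin_cases j <;> simp [bipyramidVertex, bipyramidCone]) (by decide)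
  obtain ⟨g₄, d₄, hd₄, hg₄, hs₄⟩ := hslice 4 (by norm_num) (by norm_num) ![1, 2]
    (by ext j; fin_cases j <;> simp [bipyramidVertex, bipyramidCone]) (by decide)
  obtain ⟨g₃, d₃, hd₃, hg₃, hs₃⟩ := hslice 3 (by norm_num) (by norm_num) ![1, 2]
    (by ext j; fin_cases j <;> simp [bipyramidVertex, bipyramidCone]) (by decide)
  obtain ⟨g₂, d₂, hd₂, hg₂, hs₂⟩ := hslice 2 (by norm_num) (by norm_num) ![2]
    (by ext j; fin_cases j <;> simp [bipyramidVertex, bipyramidCone]) (by decide)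
  have hfac : ∀ k, 0 < (g₅ (w 0) - g₅ (w (Fin.succAbove 0 k))) / (g₅ (w 0) - d₅) := fun k =>
    div_pos (sub_pos.2 ((hg₅ _ (Fin.succAbove_ne 0 k)).trans hd₅)) (sub_pos.2 hd₅)
  have hsq := (h.slice 0 (fun k => hg₅ _ (Fin.succAbove_ne 0 k)) hd₅).isCombCube
    (fun k => by
      rw [mul_pos_iff_of_pos_right (hfac k), hpos]
      revert k
      decide)
    (fun k => by
      rw [← neg_pos, ← neg_mul, mul_pos_iff_of_pos_right (hfac k), neg_pos, hneg]
      revert k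
      decide)
  refine ⟨cs, fun i =>
    if i = 5 then convexHull ℝ (range fun k => slicePoint g₅ d₅ (w 0) (w (Fin.succAbove 0 k)))
    else if i = 4 then convexHull ℝ (range fun k => slicePoint g₄ d₄ (w 3) (w (![1, 2] k)))
    else if i = 3 then convexHull ℝ (range fun k => slicePoint g₃ d₃ (w 4) (w (![1, 2] k)))
    else convexHull ℝ (range fun k => slicePoint g₂ d₂ (w 1) (w (![2] k))),
    ?_, ⟨slicePoint g₂ d₂ (w 1) (w 2), ?_⟩, hsegment g₃ d₃ 4 (by decide) hd₃ hg₃,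
    hsegment g₄ d₄ 3 (by decide) hd₄ hg₄, hsq⟩
  · intro i hi hi'
    interval_cases i
    exacts [hs₂, hs₃, hs₄, hs₅]
  · simp

theorem IsAffineCircuit.not_exists_simplicial_conicSeq_bipyramid {w : Fin 5 → V} {b : Fin 5 → ℝ}
    (h : IsAffineCircuit w b) (hpos : ∀ i, 0 < b i ↔ 3 ≤ i) (hneg : ∀ i, b i < 0 ↔ i < 3) :
    ¬ ∃ (ℓ : ℕ) (cs : ConicSeq (faces (convexHull ℝ (range w))) ℓ) (C : ℕ → Set V),
      cs.HasSlices C ∧ ∀ i, 2 ≤ i → i ≤ ℓ → IsSimplex (C i) := by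
  rintro ⟨ℓ, cs, C, hC, hsimp⟩
  have hS : ∀ {I : Set (Fin 5)}, IsSupported w I ↔
      I = univ ∨ ((∃ i, i ∉ I ∧ 3 ≤ i) ∧ ∃ i, i ∉ I ∧ i < 3) :=
    h.isSupported_bipyramid_iff hpos hneg
  have hsing : ∀ i, IsSupported w {i} := by
    intro i
    refine hS.2 (Or.inr ?_)
    simp only [mem_singleton_iff]
    revert i
    decide
  have hinj : Function.Injective w := by
    intro i j hij
    have := (hsing j).mem_convexHull_image_iff (i := i)
    rw [hij] at this
    simpa using this.1 (subset_convexHull ℝ _ (by simp))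
  have htop : ∀ F, F ∈ cs.cpx ℓ ↔ ∃ I, IsSupported w I ∧ F = convexHull ℝ (w '' I) := fun F => by
    rw [cs.top]
    exact isFaceOf_convexHull_range_iff
  have hvert : ∀ i, {w i} ∈ cs.cpx ℓ := fun i => (htop _).2 ⟨{i}, hsing i, by simp⟩
  have hbottom : ∀ i, {w i} ∈ cs.cpx 1 → w i = cs.v 1 := by
    intro i hi
    rw [cs.bottom] at hi
    rcases hi with hi | hi
    · exact absurd hi (singleton_ne_empty _)
    · exact singleton_injective hi
  -- every cone vertex is a vertex of the bipyramid
  have hindex : ∀ x, {x} ∈ cs.cpx ℓ → ∃ i, x = w i := by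
    intro x hx
    obtain ⟨I, -, hI⟩ := (htop _).1 hx
    rcases I.eq_empty_or_nonempty with rfl | ⟨i, hi⟩
    · simp at hI
    · have : w i ∈ ({x} : Set V) := hI ▸ subset_convexHull ℝ _ (mem_image_of_mem w hi)
      exact ⟨i, this.symm⟩
  have hℓ : 2 ≤ ℓ := by
    by_contra hlt
    obtain rfl : ℓ = 1 := by have := cs.one_le; omega
    have := hinj ((hbottom 0 (hvert 0)).trans (hbottom 1 (hvert 1)).symm)
    exact absurd this (by decide)
  obtain ⟨i, hi⟩ := hindex _ (cs.vtx_mem ℓ hℓ le_rfl)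
  have hP : convexHull ℝ (range w) ∈ cs.cpx ℓ :=
    (htop _).2 ⟨univ, hS.2 (Or.inl rfl), by rw [image_univ]⟩
  have hE : cs.E ℓ = convexHull ℝ (range w) := by
    apply Subset.antisymm
    · obtain ⟨I, -, hI⟩ := (htop _).1 (cs.E_mem ℓ hℓ le_rfl)
      rw [hI]
      exact convexHull_mono (image_subset_range _ _)
    · refine cs.E_greatest ℓ hℓ le_rfl _ hP ?_
      rw [hi]
      exact subset_convexHull ℝ _ (mem_range_self i)
  have hnext : ∀ F, F ∈ cs.cpx (ℓ - 1) ↔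
      ∃ I, IsSupported w I ∧ i ∉ I ∧ F = convexHull ℝ (w '' I) := by
    intro F
    rw [cs.step ℓ hℓ le_rfl, hE, hi]
    constructor
    · rintro ⟨hF, hF'⟩
      obtain ⟨I, hI, rfl⟩ := (htop F).1 hF
      exact ⟨I, hI, fun hiI => hF' ⟨hF, hI.mem_convexHull_image_iff.2 hiI,
        convexHull_mono (image_subset_range _ _)⟩, rfl⟩
    · rintro ⟨I, hI, hiI, rfl⟩
      exact ⟨(htop _).2 ⟨I, hI, rfl⟩, fun h' => hiI (hI.mem_convexHull_image_iff.1 h'.2.1)⟩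
  have hvert' : ∀ j, j ≠ i → {w j} ∈ cs.cpx (ℓ - 1) := fun j hj =>
    (hnext _).2 ⟨{j}, hsing j, fun h' => hj h'.symm, by simp⟩
  rcases lt_or_ge i 3 with hi3 | hi3
  · -- the first slice is a quadrilateral
    obtain ⟨g, d, hd, hg, hCe⟩ := hC ℓ hℓ le_rfl
    rw [hi] at hd
    have hg' : ∀ k, g (w (i.succAbove k)) < d := by
      intro k
      refine hg _ ⟨⟨_, hvert' _ (Fin.succAbove_ne i k), rfl⟩, ?_⟩
      rw [hE]
      exact subset_convexHull ℝ _ (mem_range_self _)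
    have hr : range w = insert (w i) (range fun k => w (i.succAbove k)) := by
      rw [show (fun k => w (i.succAbove k)) = w ∘ i.succAbove from rfl, range_comp,
        Fin.range_succAbove, ← image_insert_eq, insert_eq, union_compl_self, image_univ]
    rw [hE, hr, sep_convexHull_insert_eq hg' hd] at hCe
    have hfac : ∀ k, 0 < (g (w i) - g (w (i.succAbove k))) / (g (w i) - d) := fun k =>
      div_pos (sub_pos.2 ((hg' k).trans hd)) (sub_pos.2 hd)
    have hq := h.slice i hg' hd
    refine hq.not_isSimplex 0 (fun k => ?_) (hCe ▸ hsimp ℓ hℓ le_rfl)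
    have hcomb : ∀ i : Fin 5, i < 3 → ∀ k : Fin 4,
        (∃ m, m ≠ k ∧ 3 ≤ i.succAbove m) ∧ ∃ m, m ≠ k ∧ i.succAbove m < 3 := by decide
    obtain ⟨⟨m, hm, hm'⟩, m₂, hm₂, hm₂'⟩ := hcomb i hi3 k
    exact hq.isSupported_iff.2 (Or.inr ⟨⟨m, hm, mul_pos ((hpos _).2 hm') (hfac m)⟩,
      m₂, hm₂, mul_neg_of_neg_of_pos ((hneg _).2 hm₂') (hfac m₂)⟩)
  · -- no vertex of the remaining complex is a cone vertex
    have hℓ' : 2 ≤ ℓ - 1 := by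
      by_contra hlt
      have h1 : ℓ - 1 = 1 := by omega
      rw [h1] at hvert'
      have hne : ∀ i : Fin 5, 3 ≤ i → 0 ≠ i ∧ 1 ≠ i := by decide
      have := hinj ((hbottom 0 (hvert' 0 (hne i hi3).1)).trans
        (hbottom 1 (hvert' 1 (hne i hi3).2)).symm)
      exact absurd this (by decide)
    have hle : ℓ - 1 ≤ ℓ := Nat.sub_le _ _
    obtain ⟨I, hI, hiI, hIv⟩ := (hnext _).1 (cs.vtx_mem (ℓ - 1) hℓ' hle)
    obtain ⟨j, hj⟩ := hindex (cs.v (ℓ - 1)) ((htop _).2 ⟨I, hI, hIv⟩)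
    have hji : j ≠ i := by
      rintro rfl
      refine hiI (hI.mem_convexHull_image_iff.1 ?_)
      rw [← hIv, hj]
      rfl
    obtain ⟨J, hJ, hiJ, hJE⟩ := (hnext _).1 (cs.E_mem (ℓ - 1) hℓ' hle)
    have hjJ : j ∈ J := by
      refine hJ.mem_convexHull_image_iff.1 ?_
      rw [← hJE, ← hj]
      exact cs.v_mem_E (ℓ - 1) hℓ' hle
    obtain ⟨-, k, hk, hk3⟩ := (hS.1 hJ).resolve_left fun hu => hiJ (hu ▸ mem_univ i)
    have hcomb : ∀ i j k : Fin 5, 3 ≤ i → j ≠ i → k < 3 →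
        i ≠ k ∧ ∃ m, ¬ (m = j ∨ m = k) ∧ m < 3 := by decide
    obtain ⟨hik, m, hm, hm3⟩ := hcomb i j k hi3 hji hk3
    have hijk : i ∉ ({j, k} : Set (Fin 5)) := by
      simp [hji.symm, hik]
    have hjk : IsSupported w {j, k} := hS.2 (Or.inr ⟨⟨i, hijk, hi3⟩, m, hm, hm3⟩)
    have hsub := cs.E_greatest (ℓ - 1) hℓ' hle _ ((hnext _).2 ⟨_, hjk, hijk, rfl⟩) (by
      rw [hj]
      exact hjk.mem_convexHull_image_iff.2 (by simp))
    rw [hJE, hJ.convexHull_image_subset_iff] at hsub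
    exact hk (hsub (by simp))

/-- **Example 2.4.** A triangular bipyramid (the convex hull of a triangle together with two
apex points on opposite sides of its plane) is conic but not Δ-conic: it admits a conic
sequence with corresponding sequence of polytopes `𝒞 = {pt, I, I, I²}`, but no Δ-conic
sequence. -/
theorem triangular_bipyramid_conic_not_delta_conic
    (t₀ t₁ t₂ p q : Fin 3 → ℝ) (htri : AffineIndependent ℝ ![t₀, t₁, t₂])
    (f : (Fin 3 → ℝ) →L[ℝ] ℝ) (c : ℝ)
    (h₀ : f t₀ = c) (h₁ : f t₁ = c) (h₂ : f t₂ = c)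
    (hq : f q < c) (hp : c < f p)
    (hcross : ∃ x ∈ openSegment ℝ p q,
      x ∈ intrinsicInterior ℝ (convexHull ℝ {t₀, t₁, t₂}))
    (P : Set (Fin 3 → ℝ)) (hP : P = convexHull ℝ {t₀, t₁, t₂, p, q}) :
    (∃ (cs : ConicSeq (faces P) 5) (C : ℕ → Set (Fin 3 → ℝ)), cs.HasSlices C ∧
      (∃ w, C 2 = {w}) ∧ IsSegment (C 3) ∧ IsSegment (C 4) ∧ IsCombCube (C 5) 2) ∧
    ¬ ∃ (ℓ : ℕ) (cs : ConicSeq (faces P) ℓ) (C : ℕ → Set (Fin 3 → ℝ)),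
        cs.HasSlices C ∧ ∀ i, 2 ≤ i → i ≤ ℓ → IsSimplex (C i) := by
  obtain ⟨b, hb, hpos, hneg⟩ := exists_isAffineCircuit_bipyramid htri h₀ h₁ h₂ hp hcross
  have hrange : ({t₀, t₁, t₂, p, q} : Set (Fin 3 → ℝ)) = range ![t₀, t₁, t₂, p, q] := by
    ext y
    simp [eq_comm]
    tauto
  rw [hrange] at hP
  subst hP
  exact ⟨hb.exists_conicSeq_bipyramid hpos hneg,
    hb.not_exists_simplicial_conicSeq_bipyramid hpos hneg⟩
end

section
/- For every n ≥ 4, the n-gonal bipyramid (the convex hull of a convex n-gon together with two apex points on opposite sides of its plane) does not admit a conic sequence. In particular, the octahedron is not a conic polytope. -/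
open Set Polynomial Metric

/-! ### Polytopes, faces, and conic sequences -/

variable {V : Type*} [NormedAddCommGroup V] [NormedSpace ℝ V]

/-! ### Exposed faces and conic sequences -/

/-- A linear functional on a convex hull attaining its upper bound `M` exposes the face on which
it equals `M`. -/
theorem exists_face_of_le {S : Set V} (l : V →L[ℝ] ℝ) {M : ℝ} (hle : ∀ y ∈ S, l y ≤ M)
    {q : V} (hq : q ∈ S) (hqM : l q = M) :
    ∃ F ∈ faces (convexHull ℝ S), ∀ y ∈ S, y ∈ F ↔ l y = M := by
  have hP : ∀ y ∈ convexHull ℝ S, l y ≤ M := fun y hy =>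
    convexHull_min hle (convex_halfSpace_le l.toLinearMap.isLinear M) hy
  refine ⟨l.toExposed (convexHull ℝ S), ContinuousLinearMap.toExposed.isExposed, fun y hy => ?_⟩
  constructor
  · intro h
    refine le_antisymm (hle y hy) ?_
    rw [← hqM]
    exact h.2 q (subset_convexHull ℝ S hq)
  · intro h
    exact ⟨subset_convexHull ℝ S hy, fun z hz => by rw [h]; exact hP z hz⟩

theorem mem_of_singleton_mem_faces {S : Set V} {u : V} (h : {u} ∈ faces (convexHull ℝ S)) :
    u ∈ S :=
  extremePoints_convexHull_subset (isExtreme_singleton.1 (IsExposed.isExtreme h))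

/-- If no vertex is a cone vertex after the removal of the star of any vertex, then there is no
conic sequence. -/
theorem not_conicSeq_of_no_cone_vertex {P : Set V} (hP : P.Nontrivial)
    (H : ∀ (w u : V) (E : Set V), {w} ∈ faces P → {u} ∈ faces P → u ≠ w → E ∈ faces P → w ∉ E →
      u ∈ E → ¬ ∀ F ∈ faces P, w ∉ F → u ∈ F → F ⊆ E) :
    ¬ ∃ ℓ : ℕ, Nonempty (ConicSeq (faces P) ℓ) := by
  rintro ⟨ℓ, ⟨cs⟩⟩
  have hPP : P ∈ faces P := IsExposed.refl P
  rcases Nat.lt_or_ge ℓ 2 with hℓ | hℓ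
  · obtain rfl : ℓ = 1 := le_antisymm (by lia) cs.one_le
    rw [← cs.top, cs.bottom] at hPP
    rcases hPP with h | h
    · exact hP.nonempty.ne_empty h
    · exact hP.ne_singleton h
  have hK : cs.cpx (ℓ - 1) = {F | F ∈ faces P ∧ cs.v ℓ ∉ F} := by
    rw [cs.step ℓ hℓ le_rfl]
    ext F
    have htop : F ∈ cs.cpx ℓ ↔ F ∈ faces P := by rw [cs.top]
    rw [mem_ofPred_eq, ← htop]
    constructor
    · rintro ⟨h1, h2⟩
      exact ⟨h1, fun h => h2 ⟨h1, h, cs.E_greatest ℓ hℓ le_rfl F h1 h⟩⟩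
    · rintro ⟨h1, h2⟩
      exact ⟨h1, fun h => h2 h.2.1⟩
  have hw : {cs.v ℓ} ∈ faces P := by
    have := cs.vtx_mem ℓ hℓ le_rfl
    rwa [cs.top] at this
  have key : ∀ (u : V) (E : Set V), {u} ∈ cs.cpx (ℓ - 1) → E ∈ cs.cpx (ℓ - 1) → u ∈ E →
      ¬ ∀ F ∈ cs.cpx (ℓ - 1), u ∈ F → F ⊆ E := by
    intro u E hu hE huE hF
    rw [hK] at hu hE hF
    exact H (cs.v ℓ) u E hw hu.1 (fun h => hu.2 h.symm) hE.1 hE.2 huE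
      fun F h1 h2 h3 => hF F ⟨h1, h2⟩ h3
  rcases Nat.lt_or_ge (ℓ - 1) 2 with h1 | h1
  · have h2 : ℓ - 1 = 1 := by lia
    rw [h2, cs.bottom] at key
    refine key (cs.v 1) {cs.v 1} (by simp) (by simp) (by simp) ?_
    rintro F (rfl | rfl) h
    · simp
    · exact subset_rfl
  · exact key (cs.v (ℓ - 1)) (cs.E (ℓ - 1)) (cs.vtx_mem _ h1 (by lia)) (cs.E_mem _ h1 (by lia))
      (cs.v_mem_E _ h1 (by lia)) (cs.E_greatest _ h1 (by lia))

/-! ### Bipyramids -/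

/-- Points `v i` in strictly convex position on the hyperplane `f = c`, with apexes `p`, `q` off
that hyperplane whose open segment meets it in a point `x` relatively interior to the convex hull
of the `v i`. Both convexity conditions are expressed through linear functionals. -/
structure IsBipyramid {ι : Type*} (v : ι → V) (f : V →L[ℝ] ℝ) (c : ℝ) (p q x : V) : Prop where
  base : ∀ i, f (v i) = c
  exposed : ∀ k, ∃ s : V →L[ℝ] ℝ, ∀ i, i ≠ k → s (v k) < s (v i)
  apex_left : f p ≠ c
  apex_right : f q ≠ c
  mem : x ∈ openSegment ℝ p q
  apply_eq : f x = c
  interior : ∀ g : V →L[ℝ] ℝ, (∀ i, g x ≤ g (v i)) → ∀ i, g (v i) = g x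

namespace IsBipyramid

variable {ι : Type*} {v : ι → V} {f : V →L[ℝ] ℝ} {c : ℝ} {p q x : V}

theorem symm (hb : IsBipyramid v f c p q x) : IsBipyramid v f c q p x :=
  { hb with
    apex_left := hb.apex_right
    apex_right := hb.apex_left
    mem := openSegment_symm ℝ p q ▸ hb.mem }

/-- A face of the base cut out by a functional `h` spans, together with the apex `q`, a face of
the bipyramid. -/
theorem exists_face (hb : IsBipyramid v f c p q x) (h : V →L[ℝ] ℝ) {k j : ι}
    (hk : ∀ i, h (v k) ≤ h (v i)) (hj : h (v k) < h (v j)) :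
    ∃ F ∈ faces (convexHull ℝ (range v ∪ {p, q})), q ∈ F ∧ p ∉ F ∧
      ∀ i, v i ∈ F ↔ h (v i) = h (v k) := by
  have hx : h (v k) < h x := by
    by_contra! hle
    have := hb.interior h fun i => hle.trans (hk i)
    linarith [this k, this j]
  obtain ⟨a, b, ha, hb0, hab, hxe⟩ := hb.mem
  have hqc : f q - c ≠ 0 := sub_ne_zero.2 hb.apex_right
  set α := (h q - h (v k)) / (f q - c) with hα
  have hαq : α * (f q - c) = h q - h (v k) := by rw [hα]; field_simp
  have hfx : a * f p + b * f q = c := by rw [← hb.apply_eq, ← hxe]; simp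
  have hhx : h x = a * h p + b * h q := by rw [← hxe]; simp
  set l : V →L[ℝ] ℝ := α • f - h with hl
  have hlv : ∀ i, l (v i) = α * c - h (v i) := fun i => by simp [hl, hb.base i]
  have hlq : l q = α * c - h (v k) := by simp [hl]; linarith
  have hlp : l p < α * c - h (v k) := by
    have h1 : l p = α * f p - h p := by simp [hl]
    rw [h1]
    have h2 : a * (α * f p - h p) < a * (α * c - h (v k)) := by
      have : b = 1 - a := by linarith
      subst this
      have e1 : α * (a * f p + (1 - a) * f q) = α * c := by rw [hfx]
      nlinarith
    exact lt_of_mul_lt_mul_left h2 ha.le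
  obtain ⟨F, hF, hFm⟩ := exists_face_of_le (S := range v ∪ {p, q}) l (M := α * c - h (v k))
    (by
      rintro y (⟨i, rfl⟩ | rfl | rfl)
      · rw [hlv]; linarith [hk i]
      · exact hlp.le
      · exact hlq.le) (q := q) (by simp) hlq
  refine ⟨F, hF, (hFm q (by simp)).2 hlq, fun hp => hlp.ne ((hFm p (by simp)).1 hp), fun i => ?_⟩
  rw [hFm (v i) (Or.inl ⟨i, rfl⟩), hlv]
  constructor <;> intro h <;> linarith

theorem injective (hb : IsBipyramid v f c p q x) : Function.Injective v := by
  intro i j hij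
  by_contra hne
  obtain ⟨s, hs⟩ := hb.exposed j
  exact (hs i hne).ne (by rw [hij])

/-- Three distinct base points are not collinear. -/
theorem linearIndependent (hb : IsBipyramid v f c p q x) {i j k : ι} (hij : i ≠ j) (hik : i ≠ k)
    (hjk : j ≠ k) : LinearIndependent ℝ ![v i - v k, v j - v k] := by
  rw [LinearIndependent.pair_iff]
  intro a b hab
  obtain ⟨s, hs⟩ := hb.exposed i
  obtain ⟨t, ht⟩ := hb.exposed j
  obtain ⟨r, hr⟩ := hb.exposed k
  have hs0 := congrArg s hab
  have ht0 := congrArg t hab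
  have hr0 := congrArg r hab
  simp only [map_add, map_smul, map_sub, smul_eq_mul, map_zero] at hs0 ht0 hr0
  have s1 := hs j hij.symm
  have s2 := hs k hik.symm
  have t1 := ht i hij
  have t2 := ht k hjk.symm
  have r1 := hr i hik
  have r2 := hr j hjk
  have ha : a = 0 := by
    rcases lt_trichotomy a 0 with h | h | h
    · rcases le_or_gt (a + b) 0 with h' | h'
      · rcases le_or_gt b 0 with h'' | h''
        · nlinarith
        · nlinarith [mul_pos h'' (sub_pos.2 t1), mul_nonneg (neg_nonneg.2 h') (sub_pos.2 t2).le]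
      · nlinarith
    · exact h
    · rcases le_or_gt 0 (a + b) with h' | h'
      · rcases le_or_gt 0 b with h'' | h''
        · nlinarith
        · nlinarith
      · nlinarith
  subst ha
  refine ⟨rfl, ?_⟩
  rw [zero_mul, zero_add] at hr0
  exact (mul_eq_zero.1 hr0).resolve_right (by linarith)

/-- A functional taking one value on an apex and on three distinct base points vanishes. -/
theorem eq_zero_of_eq (hb : IsBipyramid v f c p q x) (hV : Module.finrank ℝ V = 3) {i j k : ι}
    (hij : i ≠ j) (hik : i ≠ k) (hjk : j ≠ k) (g : V →L[ℝ] ℝ) (hi : g (v i) = g q)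
    (hj : g (v j) = g q) (hk : g (v k) = g q) : g = 0 := by
  have hli := LinearIndependent.pair_iff.1 (hb.linearIndependent hij hik hjk)
  have h3 : LinearIndependent ℝ ![v i - v k, v j - v k, q - v k] := by
    rw [Fintype.linearIndependent_iff]
    intro a ha
    simp only [Fin.sum_univ_three, Matrix.cons_val_zero, Matrix.cons_val_one,
      Matrix.cons_val] at ha
    have h2 : a 2 = 0 := by
      have := congrArg f ha
      simp only [map_add, map_smul, map_sub, hb.base, sub_self, mul_zero, zero_add, map_zero,
        smul_eq_mul] at this
      exact (mul_eq_zero.1 this).resolve_right (sub_ne_zero.2 hb.apex_right)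
    rw [h2, zero_smul, add_zero] at ha
    obtain ⟨h0, h1⟩ := hli _ _ ha
    intro n
    fin_cases n
    · exact h0
    · exact h1
    · exact h2
  have hspan := h3.span_eq_top_of_card_eq_finrank (by simp [hV])
  ext y
  have hy : y ∈ Submodule.span ℝ (range ![v i - v k, v j - v k, q - v k]) := hspan ▸ trivial
  have hle : Submodule.span ℝ (range ![v i - v k, v j - v k, q - v k]) ≤ g.toLinearMap.ker := by
    rw [Submodule.span_le]
    rintro _ ⟨n, rfl⟩
    fin_cases n <;> simp [hi, hj, hk]
  exact hle hy

/-- A face through an apex and three distinct base points is the whole bipyramid. -/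
theorem mem_face (hb : IsBipyramid v f c p q x) (hV : Module.finrank ℝ V = 3) {i j k : ι}
    (hij : i ≠ j) (hik : i ≠ k) (hjk : j ≠ k) {E P : Set V} (hE : E ∈ faces P) (hi : v i ∈ E)
    (hj : v j ∈ E) (hk : v k ∈ E) (hq : q ∈ E) {y : V} (hy : y ∈ P) : y ∈ E := by
  obtain ⟨g, rfl⟩ := hE ⟨q, hq⟩
  have hg := hb.eq_zero_of_eq hV hij hik hjk g (le_antisymm (hq.2 _ hi.1) (hi.2 _ hq.1))
    (le_antisymm (hq.2 _ hj.1) (hj.2 _ hq.1)) (le_antisymm (hq.2 _ hk.1) (hk.2 _ hq.1))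
  exact ⟨hy, fun z _ => by simp [hg]⟩

/-- Each base point lies on an edge to the apex `q`. -/
theorem exists_edge (hb : IsBipyramid v f c p q x) [Nontrivial ι] (k : ι) :
    ∃ F ∈ faces (convexHull ℝ (range v ∪ {p, q})), q ∈ F ∧ p ∉ F ∧ ∀ i, v i ∈ F ↔ i = k := by
  obtain ⟨s, hs⟩ := hb.exposed k
  obtain ⟨j, hj⟩ := exists_ne k
  obtain ⟨F, hF, h1, h2, h3⟩ := hb.exists_face s (k := k) (j := j)
    (fun i => by
      rcases eq_or_ne i k with rfl | h
      · exact le_rfl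
      · exact (hs i h).le) (hs j hj)
  refine ⟨F, hF, h1, h2, fun i => (h3 i).trans ⟨fun h => ?_, fun h => by rw [h]⟩⟩
  by_contra hne
  exact (hs i hne).ne' h

/-- An apex is not a cone vertex after the removal of another vertex. -/
theorem apex_not_cone (hb : IsBipyramid v f c p q x) (hV : Module.finrank ℝ V = 3) [Fintype ι]
    (hι : 4 ≤ Fintype.card ι) {w : V} (hw : w ∈ range v ∪ {p}) {E : Set V}
    (hE : E ∈ faces (convexHull ℝ (range v ∪ {p, q}))) (hwE : w ∉ E) (hqE : q ∈ E)
    (hmax : ∀ F ∈ faces (convexHull ℝ (range v ∪ {p, q})), w ∉ F → q ∈ F → F ⊆ E) : False := by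
  classical
  have : Nontrivial ι := Fintype.one_lt_card_iff_nontrivial.1 (by lia)
  have hwP : w ∈ convexHull ℝ (range v ∪ {p, q}) := by
    apply subset_convexHull
    rcases hw with h | h
    · exact Or.inl h
    · exact Or.inr (Or.inl h)
  obtain ⟨j, hj⟩ : ∃ j, ∀ i, i ≠ j → v i ∈ E := by
    rcases hw with ⟨j, rfl⟩ | rfl
    · refine ⟨j, fun i hij => ?_⟩
      obtain ⟨F, hF, h1, -, h3⟩ := hb.exists_edge i
      exact hmax F hF (fun h => hij ((h3 j).1 h).symm) h1 ((h3 i).2 rfl)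
    · obtain ⟨j, -⟩ := exists_pair_ne ι
      refine ⟨j, fun i _ => ?_⟩
      obtain ⟨F, hF, h1, h2, h3⟩ := hb.exists_edge i
      exact hmax F hF h2 h1 ((h3 i).2 rfl)
  have hcard : 2 < (Finset.univ.erase j).card := by
    rw [Finset.card_erase_of_mem (Finset.mem_univ j), Finset.card_univ]
    lia
  obtain ⟨a, b, d, ha, hb', hd, hab, had, hbd⟩ := Finset.two_lt_card_iff.1 hcard
  exact hwE (hb.mem_face hV hab had hbd hE (hj a (Finset.ne_of_mem_erase ha))
    (hj b (Finset.ne_of_mem_erase hb')) (hj d (Finset.ne_of_mem_erase hd)) hqE hwP)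

/-- A face through both apexes contains the base. -/
theorem base_mem_of_apexes_mem (hb : IsBipyramid v f c p q x) {E : Set V}
    (hE : E ∈ faces (convexHull ℝ (range v ∪ {p, q}))) (hp : p ∈ E) (hq : q ∈ E) (i : ι) :
    v i ∈ E := by
  obtain ⟨g, rfl⟩ := hE ⟨q, hq⟩
  have hpq : g p = g q := le_antisymm (hq.2 _ hp.1) (hp.2 _ hq.1)
  obtain ⟨a, b, -, -, hab, hx⟩ := hb.mem
  have hgx : g x = g q := by
    rw [← hx]
    simp only [map_add, map_smul, smul_eq_mul, hpq]
    rw [← add_mul, hab, one_mul]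
  have hv : ∀ i, v i ∈ convexHull ℝ (range v ∪ {p, q}) := fun i =>
    subset_convexHull ℝ _ (Or.inl ⟨i, rfl⟩)
  have := hb.interior (-g) (fun i => by simpa [hgx] using hq.2 _ (hv i)) i
  have hgi : g (v i) = g q := by simpa [hgx] using this
  exact ⟨hv i, fun y hy => by rw [hgi]; exact hq.2 y hy⟩

/-- Each base point lies on two edges of the base. -/
theorem exists_two_base_edges (hb : IsBipyramid v f c p q x) [Fintype ι]
    (hι : 3 ≤ Fintype.card ι) (k : ι) : ∃ (i j : ι) (h h' : V →L[ℝ] ℝ), i ≠ k ∧ j ≠ k ∧ i ≠ j ∧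
      (∀ n, h (v k) ≤ h (v n)) ∧ (∀ n, h' (v k) ≤ h' (v n)) ∧ h (v i) = h (v k) ∧
      h (v k) < h (v j) ∧ h' (v j) = h' (v k) ∧ h' (v k) < h' (v i) := by
  classical
  obtain ⟨s, hs⟩ := hb.exposed k
  have hcard : 1 < (Finset.univ.erase k).card := by
    rw [Finset.card_erase_of_mem (Finset.mem_univ k), Finset.card_univ]
    lia
  obtain ⟨a, ha, b, hb', hab⟩ := Finset.one_lt_card.1 hcard
  have hak := Finset.ne_of_mem_erase ha
  have hbk := Finset.ne_of_mem_erase hb'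
  obtain ⟨r, hr⟩ : ∃ r : V →L[ℝ] ℝ,
      r (v a - v k) / s (v a - v k) ≠ r (v b - v k) / s (v b - v k) := by
    by_contra! hall
    obtain ⟨ra, hra⟩ := hb.exposed a
    obtain ⟨rb, hrb⟩ := hb.exposed b
    have h1 := hall ra
    have h2 := hall rb
    have sa : 0 < s (v a - v k) := by rw [map_sub]; exact sub_pos.2 (hs a hak)
    have sb : 0 < s (v b - v k) := by rw [map_sub]; exact sub_pos.2 (hs b hbk)
    rw [div_eq_div_iff sa.ne' sb.ne'] at h1 h2
    simp only [map_sub] at h1 h2 sa sb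
    have a1 := hra b hab.symm
    have a2 := hra k hak.symm
    have b1 := hrb a hab
    have b2 := hrb k hbk.symm
    have c1 : s (v b) - s (v k) < s (v a) - s (v k) := by nlinarith
    have c2 : s (v a) - s (v k) < s (v b) - s (v k) := by nlinarith
    exact lt_asymm c1 c2
  set ρ : ι → ℝ := fun n => r (v n - v k) / s (v n - v k) with hρ
  obtain ⟨i, hi, hmax⟩ := Finset.exists_max_image (Finset.univ.erase k) ρ ⟨a, ha⟩
  obtain ⟨j, hj, hmin⟩ := Finset.exists_min_image (Finset.univ.erase k) ρ ⟨a, ha⟩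
  have hlt : ρ j < ρ i := by
    by_contra! hle
    exact hr (by
      change ρ a = ρ b
      linarith [hmax a ha, hmax b hb', hmin a ha, hmin b hb'])
  have hik := Finset.ne_of_mem_erase hi
  have hjk := Finset.ne_of_mem_erase hj
  have hspos : ∀ n, n ≠ k → 0 < s (v n) - s (v k) := fun n hn => sub_pos.2 (hs n hn)
  have hmul : ∀ n, n ≠ k → r (v n) - r (v k) = ρ n * (s (v n) - s (v k)) := by
    intro n hn
    have := (hspos n hn).ne'
    simp only [hρ, map_sub]
    field_simp
  refine ⟨i, j, ρ i • s - r, r - ρ j • s, hik, hjk, fun h => hlt.ne (by rw [h]), ?_, ?_, ?_, ?_,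
    ?_, ?_⟩
  · intro n
    rcases eq_or_ne n k with rfl | hn
    · exact le_rfl
    · have := hmax n (Finset.mem_erase.2 ⟨hn, Finset.mem_univ n⟩)
      simp only [sub_apply, smul_apply, smul_eq_mul]
      nlinarith [hmul n hn, mul_nonneg (sub_nonneg.2 this) (hspos n hn).le]
  · intro n
    rcases eq_or_ne n k with rfl | hn
    · exact le_rfl
    · have := hmin n (Finset.mem_erase.2 ⟨hn, Finset.mem_univ n⟩)
      simp only [sub_apply, smul_apply, smul_eq_mul]
      nlinarith [hmul n hn, mul_nonneg (sub_nonneg.2 this) (hspos n hn).le]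
  all_goals
    simp only [sub_apply, smul_apply, smul_eq_mul]
  · linarith [hmul i hik]
  · nlinarith [hmul j hjk, mul_pos (sub_pos.2 hlt) (hspos j hjk)]
  · linarith [hmul j hjk]
  · nlinarith [hmul i hik, mul_pos (sub_pos.2 hlt) (hspos i hik)]

/-- A base point is not a cone vertex after the removal of an apex. -/
theorem base_not_cone_of_apex (hb : IsBipyramid v f c p q x) (hV : Module.finrank ℝ V = 3)
    [Fintype ι] (hι : 4 ≤ Fintype.card ι) {k : ι} {E : Set V}
    (hE : E ∈ faces (convexHull ℝ (range v ∪ {p, q}))) (hpE : p ∉ E) (hkE : v k ∈ E)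
    (hmax : ∀ F ∈ faces (convexHull ℝ (range v ∪ {p, q})), p ∉ F → v k ∈ F → F ⊆ E) :
    False := by
  obtain ⟨i, j, h, h', hik, hjk, hij, hn, hn', hi, hj, hj', hi'⟩ :=
    hb.exists_two_base_edges (by lia) k
  obtain ⟨F, hF, hq, hp, hFi⟩ := hb.exists_face h hn hj
  obtain ⟨F', hF', hq', hp', hFj⟩ := hb.exists_face h' hn' hi'
  have hFE := hmax F hF hp ((hFi k).2 rfl)
  have hFE' := hmax F' hF' hp' ((hFj k).2 rfl)
  exact hpE (hb.mem_face hV hij hik hjk hE (hFE ((hFi i).2 hi)) (hFE' ((hFj j).2 hj')) hkE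
    (hFE hq) (subset_convexHull ℝ _ (by simp)))

/-- A bipyramid over a polygon with at least four vertices has no conic sequence. -/
theorem not_conicSeq (hb : IsBipyramid v f c p q x) (hV : Module.finrank ℝ V = 3) [Fintype ι]
    (hι : 4 ≤ Fintype.card ι) :
    ¬ ∃ ℓ : ℕ, Nonempty (ConicSeq (faces (convexHull ℝ (range v ∪ {p, q}))) ℓ) := by
  have : Nontrivial ι := Fintype.one_lt_card_iff_nontrivial.1 (by lia)
  have hcomm : range v ∪ {p, q} = range v ∪ {q, p} := by rw [pair_comm]
  apply not_conicSeq_of_no_cone_vertex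
  · obtain ⟨a, b, hab⟩ := exists_pair_ne ι
    exact ⟨v a, subset_convexHull ℝ _ (by simp), v b, subset_convexHull ℝ _ (by simp),
      hb.injective.ne hab⟩
  intro w u E hw hu huw hE hwE huE hmax
  have hw := mem_of_singleton_mem_faces hw
  rcases mem_of_singleton_mem_faces hu with ⟨k, rfl⟩ | rfl | rfl
  · rcases hw with ⟨j, rfl⟩ | rfl | rfl
    · have hjk : j ≠ k := fun h => huw (by rw [h])
      obtain ⟨F, hF, hq, -, h3⟩ := hb.exists_edge k
      obtain ⟨F', hF', hp, -, h3'⟩ := hb.symm.exists_edge k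
      rw [← hcomm] at hF'
      exact hwE (hb.base_mem_of_apexes_mem hE
        (hmax F' hF' (fun h => hjk ((h3' j).1 h)) ((h3' k).2 rfl) hp)
        (hmax F hF (fun h => hjk ((h3 j).1 h)) ((h3 k).2 rfl) hq) j)
    · exact hb.base_not_cone_of_apex hV hι hE hwE huE hmax
    · rw [hcomm] at hE hmax
      exact hb.symm.base_not_cone_of_apex hV hι hE hwE huE hmax
  · rw [hcomm] at hE hmax hw
    refine hb.symm.apex_not_cone hV hι ?_ hE hwE huE hmax
    rcases hw with h | rfl | rfl
    · exact Or.inl h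
    · exact Or.inr rfl
    · exact absurd rfl huw
  · refine hb.apex_not_cone hV hι ?_ hE hwE huE hmax
    rcases hw with h | rfl | rfl
    · exact Or.inl h
    · exact Or.inr rfl
    · exact absurd rfl huw

end IsBipyramid

/-- A segment ending at a relatively interior point of a set can be prolonged within the set. -/
theorem exists_pos_add_smul_sub_mem_of_mem_intrinsicInterior {s : Set V} {x y : V}
    (hx : x ∈ intrinsicInterior ℝ s) (hy : y ∈ s) : ∃ ε > (0 : ℝ), x + ε • (x - y) ∈ s := by
  obtain ⟨x', hx', rfl⟩ := hx
  have hline : ∀ t : ℝ, (x' : V) + t • ((x' : V) - y) ∈ affineSpan ℝ s := fun t => by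
    have := AffineMap.lineMap_mem (1 + t) (subset_affineSpan ℝ s hy) x'.2
    rw [AffineMap.lineMap_apply_module'] at this
    convert this using 1
    module
  let φ : ℝ → affineSpan ℝ s := fun t => ⟨_, hline t⟩
  have hφ : Continuous φ := by
    apply Continuous.subtype_mk
    fun_prop
  have h0 : φ 0 = x' := by simp [φ]
  have hmem : ∀ᶠ t in nhds (0 : ℝ), φ t ∈ ((↑) ⁻¹' s : Set (affineSpan ℝ s)) :=
    hφ.continuousAt.eventually_mem (by rw [h0]; exact mem_interior_iff_mem_nhds.1 hx')
  obtain ⟨δ, hδ, hball⟩ := Metric.eventually_nhds_iff.1 hmem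
  refine ⟨δ / 2, by positivity, hball ?_⟩
  rw [Real.dist_eq, sub_zero, abs_of_pos (by positivity)]
  linarith

/-- A functional minimal over a set at a relatively interior point is constant on the set. -/
theorem eq_of_forall_le_of_mem_intrinsicInterior {s : Set V} {x y : V} (g : V →L[ℝ] ℝ)
    (hx : x ∈ intrinsicInterior ℝ s) (hg : ∀ z ∈ s, g x ≤ g z) (hy : y ∈ s) : g y = g x := by
  obtain ⟨ε, hε, hmem⟩ := exists_pos_add_smul_sub_mem_of_mem_intrinsicInterior hx hy
  have h1 := hg _ hmem
  simp only [map_add, map_smul, map_sub, smul_eq_mul] at h1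
  refine le_antisymm ?_ (hg y hy)
  by_contra! h
  nlinarith

theorem exists_forall_lt_of_notMem_convexHull_image {ι : Type*} [Finite ι] {v : ι → V} {k : ι}
    (h : v k ∉ convexHull ℝ (v '' {i | i ≠ k})) :
    ∃ s : V →L[ℝ] ℝ, ∀ i, i ≠ k → s (v k) < s (v i) := by
  have hclosed : IsClosed (convexHull ℝ (v '' {i | i ≠ k})) :=
    ((Set.toFinite (v '' {i | i ≠ k})).isCompact_convexHull (𝕜 := ℝ)).isClosed
  obtain ⟨s, u, hu, hs⟩ := geometric_hahn_banach_point_closed (convex_convexHull ℝ _) hclosed h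
  exact ⟨s, fun i hi => hu.trans (hs _ (subset_convexHull ℝ _ ⟨i, hi, rfl⟩))⟩

theorem isBipyramid_octahedron :
    IsBipyramid (ι := Fin 4) ![Pi.single 0 1, Pi.single 0 (-1), Pi.single 1 1, Pi.single 1 (-1)]
      (ContinuousLinearMap.proj (R := ℝ) (φ := fun _ : Fin 3 => ℝ) 2) 0
      (Pi.single 2 1) (Pi.single 2 (-1)) 0 where
  base i := by fin_cases i <;> simp
  exposed k := by
    let e (i : Fin 3) := ContinuousLinearMap.proj (R := ℝ) (φ := fun _ : Fin 3 => ℝ) i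
    refine ⟨![-e 0, e 0, -e 1, e 1] k, fun i hi => ?_⟩
    fin_cases k <;> fin_cases i <;> simp_all [e]
  apex_left := by simp
  apex_right := by simp
  mem := ⟨1 / 2, 1 / 2, by norm_num, by norm_num, by norm_num, by
    ext i; fin_cases i <;> simp⟩
  apply_eq := by simp
  interior g hg i := by
    have h0 := hg 0
    have h1 := hg 1
    have h2 := hg 2
    have h3 := hg 3
    simp only [Pi.single_neg, map_neg, map_zero, Matrix.cons_val] at h0 h1 h2 h3
    fin_cases i <;> simp [Pi.single_neg] <;> linarith

/-- For every `m ≥ 4`, the `m`-gonal bipyramid (the convex hull of a convex `m`-gon together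
with two apex points on opposite sides of its plane) does not admit a conic sequence. In
particular, the octahedron is not a conic polytope. -/
theorem ngonal_bipyramid_not_conic :
    (∀ (m : ℕ), 4 ≤ m → ∀ (v : Fin m → (Fin 3 → ℝ)) (f : (Fin 3 → ℝ) →L[ℝ] ℝ) (c : ℝ)
      (p q : Fin 3 → ℝ),
      (∀ j, f (v j) = c) →
      (∀ j, v j ∉ convexHull ℝ (v '' {k | k ≠ j})) →
      f q < c → c < f p →
      (∃ x ∈ openSegment ℝ p q, x ∈ intrinsicInterior ℝ (convexHull ℝ (Set.range v))) →
      ¬ ∃ ℓ : ℕ, Nonempty (ConicSeq (faces (convexHull ℝ (Set.range v ∪ {p, q}))) ℓ)) ∧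
    ¬ ∃ ℓ : ℕ, Nonempty (ConicSeq (faces (convexHull ℝ
        {x : Fin 3 → ℝ | ∃ i, x = Pi.single i 1 ∨ x = Pi.single i (-1)})) ℓ) := by
  refine ⟨?_, ?_⟩
  · rintro m hm v f c p q hf hv hq hp ⟨x, hx, hxi⟩
    have hfx : f x = c := by
      have hsub : convexHull ℝ (range v) ⊆ {y | f y = c} := by
        refine convexHull_min ?_ (convex_hyperplane f.toLinearMap.isLinear c)
        rintro _ ⟨j, rfl⟩
        exact hf j
      exact hsub (intrinsicInterior_subset hxi)
    have hb : IsBipyramid v f c p q x :=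
      { base := hf
        exposed := fun k => exists_forall_lt_of_notMem_convexHull_image (hv k)
        apex_left := hp.ne'
        apex_right := hq.ne
        mem := hx
        apply_eq := hfx
        interior := fun g hg i => by
          refine eq_of_forall_le_of_mem_intrinsicInterior g hxi (fun z hz => ?_)
            (subset_convexHull ℝ _ ⟨i, rfl⟩)
          refine convexHull_min ?_ (convex_halfSpace_ge g.toLinearMap.isLinear (g x)) hz
          rintro _ ⟨j, rfl⟩
          exact hg j }
    exact hb.not_conicSeq (by simp) (by simpa using hm)
  · have hset : {x : Fin 3 → ℝ | ∃ i, x = Pi.single i 1 ∨ x = Pi.single i (-1)} =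
        range ![Pi.single 0 1, Pi.single 0 (-1), Pi.single 1 1, Pi.single 1 (-1)] ∪
          {Pi.single 2 1, Pi.single 2 (-1)} := by
      ext y
      simp only [Fin.exists_fin_succ, Matrix.range_cons, Matrix.range_empty]
      simp
      tauto
    rw [hset]
    exact isBipyramid_octahedron.not_conicSeq (by simp) (by simp)
end

section
/- The 3-dimensional Gelfand–Zetlin polytope GZ₃ = {(x₁, x₂, x₃) ∈ ℝ³ : 0 ≤ x₁ ≤ 1 ≤ x₂ ≤ 2, x₁ ≤ x₃ ≤ x₂} admits a Δ-conic sequence, and its face numbers are f₀ = 7, f₁ = 11, f₂ = 6, f₃ = 1; consequently Σ_{k=0}^{3} f_k (t² − 1)^k = 1 + 2t² + 3t⁴ + t⁶. -/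
open Set Polynomial Metric

/-! ### Polytopes, faces, and conic sequences -/

variable {V : Type*} [NormedAddCommGroup V] [NormedSpace ℝ V]

/-- The three-dimensional Gelfand–Zetlin polytope
`GZ₃ = {(x₁,x₂,x₃) : 0 ≤ x₁ ≤ 1 ≤ x₂ ≤ 2, x₁ ≤ x₃ ≤ x₂}`. -/
def GZ3 : Set (Fin 3 → ℝ) :=
  {x | 0 ≤ x 0 ∧ x 0 ≤ 1 ∧ 1 ≤ x 1 ∧ x 1 ≤ 2 ∧ x 0 ≤ x 2 ∧ x 2 ≤ x 1}

/-! ### The facets and vertices of `GZ₃` -/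

namespace GZ3

/-- The linear parts of the six affine inequalities defining `GZ₃`. -/
noncomputable def slackLin : Fin 6 → ((Fin 3 → ℝ) →L[ℝ] ℝ) :=
  ![.proj 0, -.proj 0, .proj 1, -.proj 1, .proj 2 - .proj 0, .proj 1 - .proj 2]

/-- The constant terms of the six affine inequalities defining `GZ₃`. -/
noncomputable def slackConst : Fin 6 → ℝ := ![0, 1, -1, 2, 0, 0]

/-- The six affine functions whose non-negativity defines `GZ₃`. -/
noncomputable def slack (i : Fin 6) (x : Fin 3 → ℝ) : ℝ := slackConst i + slackLin i x

lemma slack_eq (x : Fin 3 → ℝ) :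
    (fun i => slack i x) = ![x 0, 1 - x 0, x 1 - 1, 2 - x 1, x 2 - x 0, x 1 - x 2] := by
  ext i
  fin_cases i <;> simp [slack, slackConst, slackLin] <;> ring

lemma slack_apply (i : Fin 6) (x : Fin 3 → ℝ) :
    slack i x = ![x 0, 1 - x 0, x 1 - 1, 2 - x 1, x 2 - x 0, x 1 - x 2] i :=
  congrFun (slack_eq x) i

lemma mem_iff_slack (x : Fin 3 → ℝ) : x ∈ GZ3 ↔ ∀ i, 0 ≤ slack i x := by
  simp only [GZ3, mem_ofPred_eq, slack_apply, Fin.forall_fin_succ]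
  simp

/-- The vertices of `GZ₃`, listed so that they can be removed in decreasing order. -/
noncomputable def vert : Fin 7 → Fin 3 → ℝ :=
  ![![0, 1, 0], ![0, 1, 1], ![0, 2, 0], ![1, 1, 1], ![0, 2, 2], ![1, 2, 1], ![1, 2, 2]]

/-- The value of each defining inequality at each vertex. -/
def vertSlack : Fin 7 → Fin 6 → ℕ :=
  ![![0, 1, 0, 1, 0, 1], ![0, 1, 0, 1, 1, 0], ![0, 1, 1, 0, 0, 2], ![1, 0, 0, 1, 0, 0],
    ![0, 1, 1, 0, 2, 0], ![1, 0, 1, 0, 0, 1], ![1, 0, 1, 0, 1, 0]]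

lemma slack_vert (i : Fin 6) (j : Fin 7) : slack i (vert j) = vertSlack j i := by
  rw [slack_apply]
  fin_cases j <;> fin_cases i <;> simp [vert, vertSlack] <;> norm_num

lemma vert_mem (j : Fin 7) : vert j ∈ GZ3 := by
  rw [mem_iff_slack]
  intro i
  rw [slack_vert]
  positivity

lemma slack_sum {ι : Type*} (s : Finset ι) (i : Fin 6) (w : ι → ℝ) (p : ι → Fin 3 → ℝ)
    (hw : ∑ k ∈ s, w k = 1) : slack i (∑ k ∈ s, w k • p k) = ∑ k ∈ s, w k * slack i (p k) := by
  simp only [slack, map_sum, map_smul, smul_eq_mul, mul_add, Finset.sum_add_distrib,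
    ← Finset.sum_mul, hw, one_mul]

lemma exists_weights {x : Fin 3 → ℝ} (hx : x ∈ GZ3) :
    ∃ w : Fin 7 → ℝ, (∀ j, 0 ≤ w j) ∧ ∑ j, w j = 1 ∧ ∑ j, w j • vert j = x := by
  obtain ⟨h0, h1, h2, h3, h4, h5⟩ := hx
  have hseg : x 2 ∈ segment ℝ (x 0) (x 1) := by
    rw [segment_eq_Icc (h4.trans h5)]
    exact ⟨h4, h5⟩
  obtain ⟨s, t, hs, ht, hst, hx2⟩ := hseg
  simp only [smul_eq_mul] at hx2
  have ha : 0 ≤ 1 - x 0 := by linarith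
  have hb : 0 ≤ x 1 - 1 := by linarith
  have hc : 0 ≤ 2 - x 1 := by linarith
  obtain rfl : s = 1 - t := by linarith
  refine ⟨![(1 - t) * (1 - x 0) * (2 - x 1), t * (1 - x 0) * (2 - x 1),
    (1 - t) * (1 - x 0) * (x 1 - 1), x 0 * (2 - x 1), t * (1 - x 0) * (x 1 - 1),
    (1 - t) * x 0 * (x 1 - 1), t * x 0 * (x 1 - 1)], ?_, ?_, ?_⟩
  · intro j
    fin_cases j <;> simp only [Fin.reduceFinMk, Matrix.cons_val] <;> positivity
  · simp [Fin.sum_univ_succ]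
    ring
  · ext k
    fin_cases k <;> simp [Fin.sum_univ_succ, vert]
    · ring
    · ring
    · rw [← hx2]
      ring

/-! ### The face lattice -/

/-- The subset of `GZ₃` on which the inequalities in `T` are equalities. -/
def face (T : Finset (Fin 6)) : Set (Fin 3 → ℝ) := {x | x ∈ GZ3 ∧ ∀ i ∈ T, slack i x = 0}

/-- The vertices at which the inequalities in `T` are equalities. -/
def vertsOf (T : Finset (Fin 6)) : Finset (Fin 7) := {j | ∀ i ∈ T, vertSlack j i = 0}

/-- The convex hull of a set of vertices. -/
def hull (S : Finset (Fin 7)) : Set (Fin 3 → ℝ) := convexHull ℝ (vert '' S)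

/-- The vertex sets of the faces of `GZ₃`. -/
def lattice : Finset (Finset (Fin 7)) := Finset.univ.image vertsOf

lemma hull_subset_of_mono {S S' : Finset (Fin 7)} (h : S ⊆ S') : hull S ⊆ hull S' :=
  convexHull_mono (image_mono (Finset.coe_subset.2 h))

lemma hull_empty : hull ∅ = ∅ := by simp [hull]

lemma hull_singleton (j : Fin 7) : hull {j} = {vert j} := by simp [hull]

lemma convex_slack_nonneg (i : Fin 6) : Convex ℝ {x | 0 ≤ slack i x} := by
  have : {x | 0 ≤ slack i x} = {x | -slackConst i ≤ slackLin i x} := by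
    ext x
    simp [slack, neg_le_iff_add_nonneg']
  rw [this]
  exact convex_halfSpace_ge (slackLin i).isLinear _

lemma convex_slack_zero (i : Fin 6) : Convex ℝ {x | slack i x = 0} := by
  have : {x | slack i x = 0} = {x | slackLin i x = -slackConst i} := by
    ext x
    simp [slack, eq_neg_iff_add_eq_zero, add_comm]
  rw [this]
  exact convex_hyperplane (slackLin i).isLinear _

lemma convex_face (T : Finset (Fin 6)) : Convex ℝ (face T) := by
  have : face T = (⋂ i, {x | 0 ≤ slack i x}) ∩ ⋂ i ∈ T, {x | slack i x = 0} := by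
    ext x
    simp [face, mem_iff_slack]
  rw [this]
  exact (convex_iInter convex_slack_nonneg).inter (convex_iInter₂ fun i _ => convex_slack_zero i)

lemma vert_mem_face {j : Fin 7} {T : Finset (Fin 6)} : vert j ∈ face T ↔ j ∈ vertsOf T := by
  simp [face, vertsOf, vert_mem, slack_vert]

lemma face_eq_hull (T : Finset (Fin 6)) : face T = hull (vertsOf T) := by
  apply Subset.antisymm
  · rintro x ⟨hx, hT⟩
    obtain ⟨w, hw, hw1, rfl⟩ := exists_weights hx
    have key : ∀ j, w j ≠ 0 → j ∈ vertsOf T := by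
      intro j hj
      rw [← vert_mem_face]
      refine ⟨vert_mem j, fun i hi => ?_⟩
      have h := hT i hi
      rw [slack_sum _ _ _ _ hw1, Finset.sum_eq_zero_iff_of_nonneg
        (fun k _ => mul_nonneg (hw k) ((mem_iff_slack _).1 (vert_mem k) i))] at h
      exact (mul_eq_zero.1 (h j (Finset.mem_univ j))).resolve_left hj
    have hsub : ∀ f : Fin 7 → (Fin 3 → ℝ), ∑ j ∈ vertsOf T, w j • f j = ∑ j, w j • f j := by
      intro f
      refine Finset.sum_subset (Finset.subset_univ _) fun j _ hj => ?_
      rw [not_imp_comm.1 (key j) hj, zero_smul]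
    have hsub1 : ∑ j ∈ vertsOf T, w j = 1 := by
      rw [← hw1]
      exact Finset.sum_subset (Finset.subset_univ _) fun j _ hj => not_imp_comm.1 (key j) hj
    rw [← hsub]
    exact (convex_convexHull ℝ _).sum_mem (fun j _ => hw j) hsub1
      fun j hj => subset_convexHull ℝ _ (mem_image_of_mem _ hj)
  · refine convexHull_min ?_ (convex_face T)
    rintro _ ⟨j, hj, rfl⟩
    exact vert_mem_face.2 hj

lemma vert_mem_hull {j : Fin 7} {S : Finset (Fin 7)} (hS : S ∈ lattice) :
    vert j ∈ hull S ↔ j ∈ S := by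
  obtain ⟨T, -, rfl⟩ := Finset.mem_image.1 hS
  rw [← face_eq_hull, vert_mem_face]

lemma hull_subset_hull {S S' : Finset (Fin 7)} (hS : S ∈ lattice) (hS' : S' ∈ lattice) :
    hull S ⊆ hull S' ↔ S ⊆ S' :=
  ⟨fun h _ hj => (vert_mem_hull hS').1 (h ((vert_mem_hull hS).2 hj)), hull_subset_of_mono⟩

lemma hull_injOn : InjOn hull (lattice : Set (Finset (Fin 7))) := fun _ hS _ hS' h =>
  ((hull_subset_hull hS hS').1 h.subset).antisymm ((hull_subset_hull hS' hS).1 h.superset)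

lemma hull_nonempty {S : Finset (Fin 7)} : (hull S).Nonempty ↔ S.Nonempty := by
  simp [hull]

lemma hull_univ : hull Finset.univ = GZ3 := by
  have h : vertsOf ∅ = Finset.univ := by decide
  rw [← h, ← face_eq_hull]
  simp [face]

lemma maximizers_eq_face {l : (Fin 3 → ℝ) →L[ℝ] ℝ} {c : ℝ} {lam : Fin 6 → ℝ}
    (hl : ∀ x, l x = c - ∑ i, lam i * slack i x) (hlam : ∀ i, 0 ≤ lam i) {T : Finset (Fin 6)}
    (hT : ∀ i, i ∈ T ↔ lam i ≠ 0) (hne : (face T).Nonempty) :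
    {x | x ∈ GZ3 ∧ ∀ y ∈ GZ3, l y ≤ l x} = face T := by
  obtain ⟨z, hz, hzT⟩ := hne
  have hnn : ∀ y ∈ GZ3, ∀ i ∈ Finset.univ, 0 ≤ lam i * slack i y := fun y hy i _ =>
    mul_nonneg (hlam i) ((mem_iff_slack y).1 hy i)
  have hface : ∀ x ∈ face T, ∑ i, lam i * slack i x = 0 := fun x hx =>
    Finset.sum_eq_zero fun i _ => by
      by_cases hi : lam i = 0
      · simp [hi]
      · rw [hx.2 i ((hT i).2 hi), mul_zero]
  ext x
  constructor
  · rintro ⟨hx, hmax⟩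
    refine ⟨hx, fun i hi => ?_⟩
    have h := hmax z hz
    rw [hl, hl, hface z ⟨hz, hzT⟩] at h
    have h0 : ∑ i, lam i * slack i x = 0 :=
      le_antisymm (by linarith) (Finset.sum_nonneg (hnn x hx))
    rw [Finset.sum_eq_zero_iff_of_nonneg (hnn x hx)] at h0
    exact (mul_eq_zero.1 (h0 i (Finset.mem_univ i))).resolve_left ((hT i).1 hi)
  · intro hx
    refine ⟨hx.1, fun y hy => ?_⟩
    rw [hl, hl, hface x hx]
    linarith [Finset.sum_nonneg (hnn y hy)]

lemma isFaceOf_face (T : Finset (Fin 6)) : IsFaceOf (face T) GZ3 := by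
  intro hne
  refine ⟨-∑ i ∈ T, slackLin i, (maximizers_eq_face (c := ∑ i ∈ T, slackConst i)
    (lam := fun i => if i ∈ T then 1 else 0) (fun x => ?_) (fun i => ?_) (fun i => ?_) hne).symm⟩
  · simp [slack, Finset.sum_add_distrib]
  · positivity
  · simp

lemma exists_multipliers (l : (Fin 3 → ℝ) →L[ℝ] ℝ) :
    ∃ (c : ℝ) (lam : Fin 6 → ℝ), (∀ x, l x = c - ∑ i, lam i * slack i x) ∧ (∀ i, 0 ≤ lam i) ∧
      ∃ z ∈ GZ3, ∀ i, lam i ≠ 0 → slack i z = 0 := by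
  obtain ⟨p, q, r, hl⟩ : ∃ p q r : ℝ, ∀ x, l x = p * x 0 + q * x 1 + r * x 2 := by
    refine ⟨l fun j => if 0 = j then 1 else 0, l fun j => if 1 = j then 1 else 0,
      l fun j => if 2 = j then 1 else 0, fun x => ?_⟩
    have h := LinearMap.pi_apply_eq_sum_univ l.toLinearMap x
    simp only [Fin.sum_univ_three, smul_eq_mul, ContinuousLinearMap.coe_coe] at h
    rw [h, mul_comm (x 0), mul_comm (x 1), mul_comm (x 2)]
  have hm : ∀ a : ℝ, max a 0 - max (-a) 0 = a := fun a => by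
    rcases le_total a 0 with h | h
    · rw [max_eq_right h, max_eq_left (by linarith)]; ring
    · rw [max_eq_left h, max_eq_right (by linarith)]; ring
  obtain ⟨p', hp⟩ : ∃ p', p' = p - max (-r) 0 := ⟨_, rfl⟩
  obtain ⟨q', hq⟩ : ∃ q', q' = q + max r 0 := ⟨_, rfl⟩
  refine ⟨max p' 0 - max (-q') 0 + 2 * max q' 0,
    ![max (-p') 0, max p' 0, max (-q') 0, max q' 0, max (-r) 0, max r 0], fun x => ?_, ?_, ?_⟩
  · simp only [slack_apply, Fin.sum_univ_six, Matrix.cons_val, hl]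
    linear_combination (x 0) * (-hm p' - hp) + (x 1) * (-hm q' - hq) - (x 2) * hm r
  · intro i
    fin_cases i <;> simp
  · refine ⟨![if 0 < p' then 1 else 0, if 0 < q' then 2 else 1,
      if 0 < r then (if 0 < q' then 2 else 1) else (if 0 < p' then 1 else 0)], ?_, ?_⟩
    · simp only [GZ3, mem_ofPred_eq, Matrix.cons_val]
      split_ifs <;> norm_num
    · intro i
      rw [slack_apply]
      fin_cases i <;> simp only [Fin.reduceFinMk, Fin.zero_eta, Matrix.cons_val, ne_eq,
        max_eq_right_iff, not_le, Left.neg_pos_iff] <;> intro h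
      · simp [h.le]
      · simp [h]
      · simp [h.not_gt]
      · simp [h]
      · simp [h.not_gt]
      · simp [h]

lemma faces_eq : faces GZ3 = hull '' (lattice : Set (Finset (Fin 7))) := by
  ext F
  constructor
  · intro hF
    rcases F.eq_empty_or_nonempty with rfl | hne
    · exact ⟨∅, by decide +kernel, hull_empty⟩
    · obtain ⟨l, hl⟩ := hF hne
      obtain ⟨c, lam, h1, h2, z, hz, hzs⟩ := exists_multipliers l
      classical
      refine ⟨vertsOf ({i | lam i ≠ 0} : Finset (Fin 6)),
        Finset.mem_image_of_mem _ (Finset.mem_univ _), ?_⟩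
      rw [← face_eq_hull, hl]
      exact (maximizers_eq_face h1 h2 (by simp) ⟨z, hz, by simpa using hzs⟩).symm
  · rintro ⟨S, hS, rfl⟩
    obtain ⟨T, -, rfl⟩ := Finset.mem_image.1 hS
    rw [← face_eq_hull]
    exact isFaceOf_face T

/-! ### Face numbers -/

/-- The dimension of a nonempty face of `GZ₃` in terms of its number of vertices. -/
def rk (S : Finset (Fin 7)) : ℕ := ![0, 0, 1, 2, 2, 2, 2, 3] (Fin.ofNat 8 S.card)

end GZ3

lemma polyDim_lt_of_exposed [FiniteDimensional ℝ V] {P F G : Set V} (hF : IsFaceOf F P)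
    (hne : F.Nonempty) (hGP : G ⊆ P) (hFG : F ⊂ G) : polyDim F < polyDim G := by
  obtain ⟨l, hl⟩ := hF hne
  apply Submodule.finrank_lt_finrank_of_lt
  refine lt_of_le_of_ne (vectorSpan_mono ℝ hFG.subset) fun h => ?_
  obtain ⟨y, hyG, hyF⟩ := exists_of_ssubset hFG
  obtain ⟨x, hx⟩ := hne
  have hker : vectorSpan ℝ F ≤ LinearMap.ker l.toLinearMap := by
    rw [vectorSpan_def, Submodule.span_le]
    rintro _ ⟨a, ha, b, hb, rfl⟩
    rw [hl] at ha hb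
    simpa [sub_eq_zero] using le_antisymm (hb.2 a ha.1) (ha.2 b hb.1)
  have hxy : l (x - y) = 0 :=
    hker (h ▸ vsub_mem_vectorSpan ℝ (hFG.subset hx) hyG)
  rw [map_sub, sub_eq_zero] at hxy
  rw [hl] at hx hyF
  exact hyF ⟨hGP hyG, fun z hz => hxy ▸ hx.2 z hz⟩

namespace GZ3

lemma isFaceOf_hull {S : Finset (Fin 7)} (hS : S ∈ lattice) : IsFaceOf (hull S) GZ3 := by
  have : hull S ∈ faces GZ3 := faces_eq ▸ mem_image_of_mem _ hS
  exact this

lemma hull_subset (S : Finset (Fin 7)) : hull S ⊆ GZ3 :=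
  hull_univ ▸ hull_subset_of_mono (Finset.subset_univ S)

lemma polyDim_hull_lt {S S' : Finset (Fin 7)} (hS : S ∈ lattice) (hS' : S' ∈ lattice)
    (hne : S.Nonempty) (h : S ⊂ S') : polyDim (hull S) < polyDim (hull S') := by
  refine polyDim_lt_of_exposed (isFaceOf_hull hS) (hull_nonempty.2 hne) (hull_subset _)
    ⟨hull_subset_of_mono h.subset, fun h' => h.2 ((hull_subset_hull hS' hS).1 h')⟩

lemma polyDim_hull {S : Finset (Fin 7)} (hS : S ∈ lattice) (hne : S.Nonempty) :
    polyDim (hull S) = rk S := by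
  have below : ∀ S ∈ lattice, S.Nonempty → rk S = 0 ∨
      ∃ S' ∈ lattice, S'.Nonempty ∧ S' ⊂ S ∧ rk S' + 1 = rk S := by decide +kernel
  have above : ∀ S ∈ lattice, S.Nonempty → rk S = 3 ∨
      ∃ S' ∈ lattice, S'.Nonempty ∧ S ⊂ S' ∧ rk S' = rk S + 1 := by decide +kernel
  have bound : ∀ S ∈ lattice, rk S ≤ 3 := by decide +kernel
  have lower : ∀ n, ∀ S ∈ lattice, S.Nonempty → rk S = n → n ≤ polyDim (hull S) := by
    intro n
    induction n with
    | zero => intros; exact Nat.zero_le _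
    | succ n ih =>
      intro S hS hne hn
      obtain h0 | ⟨S', hS', hne', hlt, hrk⟩ := below S hS hne
      · omega
      · have h1 := ih S' hS' hne' (by omega)
        have h2 := polyDim_hull_lt hS' hS hne' hlt
        omega
  have upper : ∀ n, ∀ S ∈ lattice, S.Nonempty → rk S + n = 3 → polyDim (hull S) + n ≤ 3 := by
    intro n
    induction n with
    | zero =>
      intro S _ _ _
      exact (Submodule.finrank_le _).trans (by simp)
    | succ n ih =>
      intro S hS hne hn
      obtain h0 | ⟨S', hS', hne', hlt, hrk⟩ := above S hS hne
      · omega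
      · have h1 := ih S' hS' hne' (by omega)
        have h2 := polyDim_hull_lt hS hS' hne hlt
        omega
  have h1 := lower _ S hS hne rfl
  have h2 := upper (3 - rk S) S hS hne (by have := bound S hS; omega)
  have h3 := bound S hS
  omega

lemma faceCount_eq (k : ℕ) :
    faceCount GZ3 k = (lattice.filter fun S => S.Nonempty ∧ rk S = k).card := by
  have : {F : Set (Fin 3 → ℝ) | IsFaceOf F GZ3 ∧ F.Nonempty ∧ polyDim F = k} =
      hull '' (lattice.filter fun S => S.Nonempty ∧ rk S = k : Finset (Finset (Fin 7))) := by
    ext F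
    constructor
    · rintro ⟨hF, hne, hk⟩
      have hF' : F ∈ faces GZ3 := hF
      rw [faces_eq] at hF'
      obtain ⟨S, hS, rfl⟩ := hF'
      have hne' := hull_nonempty.1 hne
      refine ⟨S, ?_, rfl⟩
      rw [Finset.mem_coe, Finset.mem_filter]
      exact ⟨hS, hne', (polyDim_hull hS hne') ▸ hk⟩
    · rintro ⟨S, hS, rfl⟩
      rw [Finset.mem_coe, Finset.mem_filter] at hS
      exact ⟨isFaceOf_hull hS.1, hull_nonempty.2 hS.2.1, (polyDim_hull hS.1 hS.2.1).trans hS.2.2⟩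
  have hcard : faceCount GZ3 k = ({F : Set (Fin 3 → ℝ) |
      IsFaceOf F GZ3 ∧ F.Nonempty ∧ polyDim F = k}).ncard := rfl
  rw [hcard, this, (hull_injOn.mono _).ncard_image, ncard_coe_finset]
  intro S hS
  rw [Finset.mem_coe, Finset.mem_filter] at hS
  exact hS.1

lemma faceCount_zero : faceCount GZ3 0 = 7 := by rw [faceCount_eq]; decide +kernel

lemma faceCount_one : faceCount GZ3 1 = 11 := by rw [faceCount_eq]; decide +kernel

lemma faceCount_two : faceCount GZ3 2 = 6 := by rw [faceCount_eq]; decide +kernel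

lemma faceCount_three : faceCount GZ3 3 = 1 := by rw [faceCount_eq]; decide +kernel

/-! ### The conic sequence -/

/-- The equations of the greatest face containing the vertex `j` and no later vertex. -/
def apexEqs : Fin 7 → Finset (Fin 6) := ![{0, 2, 4}, {0, 2}, {0, 4}, {2}, {0}, {4}, ∅]

/-- The faces of `GZ₃` all of whose vertices are among the first `i` ones. -/
def initialFaces (i : ℕ) : Set (Set (Fin 3 → ℝ)) :=
  hull '' {S | S ∈ lattice ∧ ∀ j ∈ S, (j : ℕ) < i}

lemma vertsOf_mem (T : Finset (Fin 6)) : vertsOf T ∈ lattice :=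
  Finset.mem_image_of_mem _ (Finset.mem_univ _)

lemma singleton_mem (j : Fin 7) : {j} ∈ lattice := by
  revert j
  decide +kernel

lemma exists_fin {i : ℕ} (h2 : 2 ≤ i) (h7 : i ≤ 7) : ∃ j : Fin 7, i = j + 1 ∧ j ≠ 0 :=
  ⟨⟨i - 1, by omega⟩, by simp; omega, by simp [Fin.ext_iff]; omega⟩

lemma ofNat_eq (j : Fin 7) : Fin.ofNat 7 (j + 1 - 1 : ℕ) = j := by simp

lemma subset_apex : ∀ j : Fin 7, ∀ S ∈ lattice, (∀ k ∈ S, (k : ℕ) < (j + 1 : ℕ)) → j ∈ S →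
    S ⊆ vertsOf (apexEqs j) := by decide +kernel

/-- The conic sequence of `GZ₃` removing its vertices in decreasing order. -/
noncomputable def conicSeq : ConicSeq (faces GZ3) 7 where
  cpx := initialFaces
  v i := vert (Fin.ofNat 7 (i - 1))
  E i := hull (vertsOf (apexEqs (Fin.ofNat 7 (i - 1))))
  one_le := by norm_num
  top := by
    rw [faces_eq, initialFaces]
    congr 1
    ext S
    simp
  bottom := by
    have h : {S | S ∈ lattice ∧ ∀ j ∈ S, (j : ℕ) < 1} = {∅, {0}} := by
      have h' : lattice.filter (fun S : Finset (Fin 7) => ∀ j ∈ S, (j : ℕ) < 1) = {∅, {0}} := by decide +kernel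
      rw [← Finset.coe_filter, h']
      simp
    rw [initialFaces, h, image_pair, hull_empty, hull_singleton]
    rfl
  vtx_mem i h2 h7 := by
    obtain ⟨j, rfl, -⟩ := exists_fin h2 h7
    rw [ofNat_eq]
    exact ⟨{j}, ⟨singleton_mem j, by simp⟩, hull_singleton j⟩
  E_mem i h2 h7 := by
    obtain ⟨j, rfl, -⟩ := exists_fin h2 h7
    rw [ofNat_eq]
    refine ⟨_, ⟨vertsOf_mem _, ?_⟩, rfl⟩
    revert j
    decide
  v_mem_E i h2 h7 := by
    obtain ⟨j, rfl, -⟩ := exists_fin h2 h7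
    rw [ofNat_eq, vert_mem_hull (vertsOf_mem _)]
    revert j
    decide
  E_greatest i h2 h7 := by
    obtain ⟨j, rfl, -⟩ := exists_fin h2 h7
    rw [ofNat_eq]
    rintro _ ⟨S, ⟨hS, hlt⟩, rfl⟩ hv
    exact hull_subset_of_mono (subset_apex j S hS hlt ((vert_mem_hull hS).1 hv))
  step i h2 h7 := by
    obtain ⟨j, rfl, -⟩ := exists_fin h2 h7
    rw [ofNat_eq]
    ext F
    constructor
    · rintro ⟨S, ⟨hS, hlt⟩, rfl⟩
      refine ⟨⟨S, ⟨hS, fun k hk => (hlt k hk).trans (by omega)⟩, rfl⟩, fun h => ?_⟩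
      have := hlt j ((vert_mem_hull hS).1 h.2.1)
      omega
    · rintro ⟨⟨S, ⟨hS, hlt⟩, rfl⟩, h⟩
      refine ⟨S, ⟨hS, fun k hk => ?_⟩, rfl⟩
      have hkj : k ≠ j := by
        rintro rfl
        exact h ⟨⟨S, ⟨hS, hlt⟩, rfl⟩, (vert_mem_hull hS).2 hk,
          hull_subset_of_mono (subset_apex k S hS hlt hk)⟩
      have := hlt k hk
      have : (k : ℕ) ≠ j := fun h => hkj (Fin.ext h)
      omega

/-! ### The slices -/

/-- The inequalities that are equalities at the vertex `j`. -/
def tight (j : Fin 7) : Finset (Fin 6) := {i | vertSlack j i = 0}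

/-- The sum of the inequalities that are equalities at the vertex `j`. -/
noncomputable def height (j : Fin 7) (x : Fin 3 → ℝ) : ℝ := ∑ i ∈ tight j, slack i x

/-- The linear part of `-height j`. -/
noncomputable def heightLin (j : Fin 7) : (Fin 3 → ℝ) →L[ℝ] ℝ := -∑ i ∈ tight j, slackLin i

lemma heightLin_apply (j : Fin 7) (x : Fin 3 → ℝ) :
    heightLin j x = ∑ i ∈ tight j, slackConst i - height j x := by
  simp [heightLin, height, slack, Finset.sum_add_distrib]

lemma height_vert (j k : Fin 7) : height j (vert k) = (∑ i ∈ tight j, vertSlack k i : ℕ) := by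
  simp [height, slack_vert]

/-- The slice of the apex face of the vertex `j` by a hyperplane cutting off `j`. -/
noncomputable def slice (j : Fin 7) : Set (Fin 3 → ℝ) :=
  {x | x ∈ face (apexEqs j) ∧ height j x = 1 / 2}

lemma isConeSlice_slice (j : Fin 7) :
    IsConeSlice (slice j) (hull (vertsOf (apexEqs j))) (vert j) (⋃₀ initialFaces j) := by
  have hpos : ∀ j k : Fin 7, k ≠ j → 1 ≤ ∑ i ∈ tight j, vertSlack k i := by decide +kernel
  have hself : ∀ j : Fin 7, ∑ i ∈ tight j, vertSlack j i = 0 := by decide +kernel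
  refine ⟨heightLin j, ∑ i ∈ tight j, slackConst i - 1 / 2, ?_, ?_, ?_⟩
  · rw [heightLin_apply, height_vert, hself]
    norm_num
  · rintro x ⟨⟨_, ⟨S, ⟨hS, hlt⟩, rfl⟩, hx⟩, -⟩
    have hsub : hull S ⊆ {x | heightLin j x < ∑ i ∈ tight j, slackConst i - 1 / 2} := by
      refine convexHull_min ?_ (convex_halfSpace_lt (heightLin j).isLinear _)
      rintro _ ⟨k, hk, rfl⟩
      have hkj : k ≠ j := by
        rintro rfl
        exact lt_irrefl _ (hlt k hk)
      have h1 : (1 : ℝ) ≤ height j (vert k) := by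
        rw [height_vert]
        exact_mod_cast hpos j k hkj
      rw [mem_ofPred_eq, heightLin_apply]
      linarith
    exact hsub hx
  · ext x
    simp only [slice, face_eq_hull, mem_ofPred_eq, heightLin_apply, sub_right_inj]

lemma convex_slice (j : Fin 7) : Convex ℝ (slice j) := by
  have : slice j = face (apexEqs j) ∩
      {x | heightLin j x = ∑ i ∈ tight j, slackConst i - 1 / 2} := by
    ext x
    simp only [slice, mem_inter_iff, mem_ofPred_eq, heightLin_apply, sub_right_inj]
  rw [this]
  exact (convex_face _).inter (convex_hyperplane (heightLin j).isLinear _)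

end GZ3

lemma isSimplex_of_linearIndependent {n : ℕ} [NeZero n] {p : Fin n → V}
    (hp : LinearIndependent ℝ p) {C : Set V} (hC : Convex ℝ C) (hpC : ∀ i, p i ∈ C)
    (hw : ∀ x ∈ C, ∃ w : Fin n → ℝ, (∀ i, 0 ≤ w i) ∧ ∑ i, w i = 1 ∧ ∑ i, w i • p i = x) :
    IsSimplex C := by
  classical
  refine ⟨Finset.univ.image p, ⟨p 0, by simp⟩, ?_, ?_⟩
  · have h : AffineIndependent ℝ ((↑) : range p → V) := hp.affineIndependent.range
    have hr : ((Finset.univ.image p : Finset V) : Set V) = range p := by simp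
    rw [← hr] at h
    exact h
  · rw [Finset.coe_image, Finset.coe_univ, image_univ]
    apply Subset.antisymm
    · intro x hx
      obtain ⟨w, h0, h1, rfl⟩ := hw x hx
      exact (convex_convexHull ℝ _).sum_mem (fun i _ => h0 i) h1
        fun i _ => subset_convexHull ℝ _ (mem_range_self i)
    · refine convexHull_min ?_ hC
      rintro _ ⟨i, rfl⟩
      exact hpC i

namespace GZ3

lemma tight_eq : tight = ![{0, 2, 4}, {0, 2, 5}, {0, 3, 4}, {1, 2, 4, 5}, {0, 3, 5}, {1, 3, 4},
    {1, 3, 5}] := by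
  decide

lemma isSimplex_slice {j : Fin 7} (hj : j ≠ 0) : IsSimplex (slice j) := by
  have hmem : ∀ k x, x ∈ slice k ↔ (x ∈ GZ3 ∧ ∀ i ∈ apexEqs k, slack i x = 0) ∧
      height k x = 1 / 2 := fun _ _ => Iff.rfl
  have hext : ∀ a b : Fin 3 → ℝ, a = b ↔ a 0 = b 0 ∧ a 1 = b 1 ∧ a 2 = b 2 := fun a b => by
    simp [funext_iff, Fin.forall_fin_succ]
  fin_cases j
  · exact absurd rfl hj
  · refine isSimplex_of_linearIndependent (p := ![![0, 1, 1 / 2]]) ?_ (convex_slice _) ?_ ?_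
    · rw [Fintype.linearIndependent_iff]
      intro g hg
      simp [hext] at hg
      simpa [Fin.forall_fin_succ] using hg
    · simp [hmem, apexEqs, height, tight_eq, slack_apply, GZ3]
      norm_num
    · intro x hx
      simp [hmem, apexEqs, height, tight_eq, slack_apply, GZ3] at hx
      refine ⟨![1], by simp, by simp, ?_⟩
      simp [hext]
      refine ⟨?_, ?_, ?_⟩ <;> linarith
  · refine isSimplex_of_linearIndependent (p := ![![0, 3 / 2, 0]]) ?_ (convex_slice _) ?_ ?_
    · rw [Fintype.linearIndependent_iff]
      intro g hg
      simp [hext] at hg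
      simpa [Fin.forall_fin_succ] using hg
    · simp [hmem, apexEqs, height, tight_eq, slack_apply, GZ3]
      norm_num
    · intro x hx
      simp [hmem, apexEqs, height, tight_eq, slack_apply, GZ3] at hx
      refine ⟨![1], by simp, by simp, ?_⟩
      simp [hext]
      refine ⟨?_, ?_, ?_⟩ <;> linarith
  · refine isSimplex_of_linearIndependent (p := ![![3 / 4, 1, 3 / 4], ![3 / 4, 1, 1]])
      ?_ (convex_slice _) ?_ ?_
    · rw [Fintype.linearIndependent_iff]
      intro g hg
      simp [hext, Fin.sum_univ_succ] at hg
      simp [Fin.forall_fin_succ]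
      constructor <;> linarith
    · simp [hmem, apexEqs, height, tight_eq, slack_apply, GZ3, Fin.forall_fin_succ]
      norm_num
    · intro x hx
      simp [hmem, apexEqs, height, tight_eq, slack_apply, GZ3] at hx
      refine ⟨![4 * (1 - x 2), 4 * x 2 - 3], ?_, ?_, ?_⟩
      · simp [Fin.forall_fin_succ]
        constructor <;> linarith
      · simp [Fin.sum_univ_succ]
        ring
      · simp [hext, Fin.sum_univ_succ]
        refine ⟨?_, ?_, ?_⟩ <;> linarith
  · refine isSimplex_of_linearIndependent (p := ![![0, 3 / 2, 3 / 2], ![0, 2, 3 / 2]])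
      ?_ (convex_slice _) ?_ ?_
    · rw [Fintype.linearIndependent_iff]
      intro g hg
      simp [hext, Fin.sum_univ_succ] at hg
      simp [Fin.forall_fin_succ]
      constructor <;> linarith
    · simp [hmem, apexEqs, height, tight_eq, slack_apply, GZ3, Fin.forall_fin_succ]
      norm_num
    · intro x hx
      simp [hmem, apexEqs, height, tight_eq, slack_apply, GZ3] at hx
      refine ⟨![4 - 2 * x 1, 2 * x 1 - 3], ?_, ?_, ?_⟩
      · simp [Fin.forall_fin_succ]
        constructor <;> linarith
      · simp [Fin.sum_univ_succ]
        ring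
      · simp [hext, Fin.sum_univ_succ]
        refine ⟨?_, ?_, ?_⟩ <;> linarith
  · refine isSimplex_of_linearIndependent (p := ![![1 / 2, 2, 1 / 2], ![1, 3 / 2, 1]])
      ?_ (convex_slice _) ?_ ?_
    · rw [Fintype.linearIndependent_iff]
      intro g hg
      simp [hext, Fin.sum_univ_succ] at hg
      simp [Fin.forall_fin_succ]
      constructor <;> linarith
    · simp [hmem, apexEqs, height, tight_eq, slack_apply, GZ3, Fin.forall_fin_succ]
      norm_num
    · intro x hx
      simp [hmem, apexEqs, height, tight_eq, slack_apply, GZ3] at hx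
      refine ⟨![2 - 2 * x 0, 2 * x 0 - 1], ?_, ?_, ?_⟩
      · simp [Fin.forall_fin_succ]
        constructor <;> linarith
      · simp [Fin.sum_univ_succ]
        ring
      · simp [hext, Fin.sum_univ_succ]
        refine ⟨?_, ?_, ?_⟩ <;> linarith
  · refine isSimplex_of_linearIndependent
      (p := ![![1 / 2, 2, 2], ![1, 2, 3 / 2], ![1, 3 / 2, 3 / 2]]) ?_ (convex_slice _) ?_ ?_
    · rw [Fintype.linearIndependent_iff]
      intro g hg
      simp [hext, Fin.sum_univ_succ] at hg
      simp [Fin.forall_fin_succ]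
      refine ⟨?_, ?_, ?_⟩ <;> linarith
    · simp [hmem, apexEqs, height, tight_eq, slack_apply, GZ3, Fin.forall_fin_succ]
      norm_num
    · intro x hx
      simp [hmem, apexEqs, height, tight_eq, slack_apply, GZ3] at hx
      refine ⟨![2 * (1 - x 0), 2 * (x 1 - x 2), 2 * (2 - x 1)], ?_, ?_, ?_⟩
      · simp [Fin.forall_fin_succ]
        refine ⟨?_, ?_, ?_⟩ <;> linarith
      · simp [Fin.sum_univ_succ]
        linarith
      · simp [hext, Fin.sum_univ_succ]
        refine ⟨?_, ?_, ?_⟩ <;> linarith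

end GZ3

/-- The Gelfand–Zetlin polytope `GZ₃` admits a Δ-conic sequence; its face numbers are
`f₀ = 7`, `f₁ = 11`, `f₂ = 6`, `f₃ = 1`, and consequently
`∑_{k=0}^3 f_k (t² - 1)^k = 1 + 2t² + 3t⁴ + t⁶`. -/
theorem GZ3_delta_conic_and_face_numbers :
    (∃ (ℓ : ℕ) (cs : ConicSeq (faces GZ3) ℓ) (C : ℕ → Set (Fin 3 → ℝ)),
      cs.HasSlices C ∧ ∀ i, 2 ≤ i → i ≤ ℓ → IsSimplex (C i)) ∧
    faceCount GZ3 0 = 7 ∧ faceCount GZ3 1 = 11 ∧ faceCount GZ3 2 = 6 ∧ faceCount GZ3 3 = 1 ∧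
    ∑ k ∈ Finset.range 4, Polynomial.C ((faceCount GZ3 k : ℚ)) * (Polynomial.X ^ 2 - 1) ^ k
      = 1 + 2 * Polynomial.X ^ 2 + 3 * Polynomial.X ^ 4 + Polynomial.X ^ 6 := by
  refine ⟨⟨7, GZ3.conicSeq, fun i => GZ3.slice (Fin.ofNat 7 (i - 1)), fun i h2 h7 => ?_,
    fun i h2 h7 => ?_⟩, GZ3.faceCount_zero, GZ3.faceCount_one, GZ3.faceCount_two,
    GZ3.faceCount_three, ?_⟩
  · obtain ⟨j, rfl, -⟩ := GZ3.exists_fin h2 h7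
    have h := GZ3.isConeSlice_slice j
    rw [← GZ3.ofNat_eq j] at h
    simpa [GZ3.conicSeq] using h
  · obtain ⟨j, rfl, hj⟩ := GZ3.exists_fin h2 h7
    simp only [GZ3.ofNat_eq]
    exact GZ3.isSimplex_slice hj
  · simp only [Finset.sum_range_succ, Finset.sum_range_zero, GZ3.faceCount_zero,
      GZ3.faceCount_one, GZ3.faceCount_two, GZ3.faceCount_three, Nat.cast_ofNat, Nat.cast_one,
      map_ofNat, map_one]
    ring
end
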